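/- arXiv:math/9604211 — 9 statements merged into one kernel-verified Lean document; each statement's English description precedes it below -/
import Mathlib

section
/- Let κ and λ be uncountable cardinals and suppose there exists a (κ,λ)-witness. Let (Ω, Σ, P) be a probability space and let Σ₀ ⊆ Σ be an algebra of measurable subsets of Ω (closed under finite unions, finite intersections and complements) of cardinality λ such that: (i) P is inner regular with respect to Σ₀, i.e. for every A ∈ Σ, P(A) = sup{P(B) : B ∈ Σ₀, B ⊆ A}; (ii) for every sequence (A_n)_{n∈ℕ} of members of Σ₀ there exists B ∈ Σ₀ with B ⊆ ⋂_{n∈ℕ} A_n and P(B) = P(⋂_{n∈ℕ} A_n); (iii) (κ-saturation) every subfamily of Σ₀ of cardinality < κ with the finite intersection property has nonempty intersection; (iv) there exists an independent sequence (A_n)_{n∈ℕ} of members of Σ₀ with P(A_n) = 1/2 for every n. Then (Ω, Σ, P) is compact in the sense of Ross; moreover an inner-regular compact family can be chosen consisting of members of Σ₀. (Paper's Theorem 2, with the properties of the Loeb space and the nonstandard universe that the proof uses stated as explicit hypotheses.) -/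
open MeasureTheory Set
open scoped ENNReal

/-- A family of sets has the finite intersection property if every finite
subfamily has nonempty intersection. -/
def HasFIP {Ω : Type*} (D : Set (Set Ω)) : Prop :=
  ∀ F : Finset (Set Ω), ↑F ⊆ D → (⋂₀ (F : Set (Set Ω))).Nonempty

/-- A family `C` of sets is compact if every subfamily with the finite
intersection property has nonempty intersection. -/
def IsCompactFamily {Ω : Type*} (C : Set (Set Ω)) : Prop :=
  ∀ D ⊆ C, HasFIP D → (⋂₀ D).Nonempty

/-- `P` is inner regular with respect to the family `C`:
for every measurable `A`, `P A = sup {P B : B ∈ C, B ⊆ A}`. -/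
def IsInnerRegularFamily {Ω : Type*} [MeasurableSpace Ω] (P : Measure Ω)
    (C : Set (Set Ω)) : Prop :=
  ∀ A : Set Ω, MeasurableSet A → P A = ⨆ (B : Set Ω) (_ : B ∈ C ∧ B ⊆ A), P B

/-- A probability space is compact in the sense of Ross if it carries an
inner-regular compact family of measurable sets. -/
def RossCompact {Ω : Type*} [MeasurableSpace Ω] (P : Measure Ω) : Prop :=
  ∃ C : Set (Set Ω), (∀ B ∈ C, MeasurableSet B) ∧
    IsInnerRegularFamily P C ∧ IsCompactFamily C

/-- A family `(A i)` of sets is independent for `P` if the measure of every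
finite intersection is the product of the measures. -/
def IndepFamily {Ω : Type*} {I : Type*} [MeasurableSpace Ω] (P : Measure Ω)
    (A : I → Set Ω) : Prop :=
  ∀ s : Finset I, P (⋂ i ∈ s, A i) = ∏ i ∈ s, P (A i)

/-- `ν` is the coin-flipping product probability measure on Cantor space
`ℕ → Bool`: every cylinder determined by finitely many coordinates `s` has
measure `(1/2) ^ |s|`. -/
def IsCoinFlipMeasure (ν : Measure (ℕ → Bool)) : Prop :=
  IsProbabilityMeasure ν ∧
    ∀ (s : Finset ℕ) (g : ℕ → Bool),
      ν {f : ℕ → Bool | ∀ n ∈ s, f n = g n} = (1 / 2 : ℝ≥0∞) ^ s.card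

/-- The map into Cantor space recording membership in the sets `A n`. -/
noncomputable def itinerary {Ω : Type*} (A : ℕ → Set Ω) (ω : Ω) (n : ℕ) : Bool :=
  open scoped Classical in decide (ω ∈ A n)

/-- The basic clopen set of Cantor space with value `true` on `s` and `false` on `t`. -/
def boolCylinder (s t : Finset ℕ) : Set (ℕ → Bool) :=
  {f | (∀ n ∈ s, f n = true) ∧ ∀ n ∈ t, f n = false}

lemma measurable_itinerary {Ω : Type*} [MeasurableSpace Ω] {A : ℕ → Set Ω}
    (hA : ∀ n, MeasurableSet (A n)) : Measurable (itinerary A) := by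
  refine measurable_pi_lambda _ fun n => measurable_to_bool ?_
  have : (fun ω => itinerary A ω n) ⁻¹' {true} = A n := by
    ext ω; simp [itinerary]
  rw [this]
  exact hA n

lemma measurableSet_boolCylinder_empty (s : Finset ℕ) : MeasurableSet (boolCylinder s ∅) := by
  have : boolCylinder s ∅ = ⋂ n ∈ s, (fun f : ℕ → Bool => f n) ⁻¹' {true} := by
    ext f; simp [boolCylinder]
  rw [this]
  exact Finset.measurableSet_biInter s fun n _ =>
    measurable_pi_apply n (measurableSet_singleton true)

lemma generateFrom_boolCylinder_empty :
    (inferInstance : MeasurableSpace (ℕ → Bool)) =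
      MeasurableSpace.generateFrom (range fun s : Finset ℕ => boolCylinder s ∅) := by
  apply le_antisymm
  · refine iSup_le fun n => ?_
    rw [← measurable_iff_comap_le]
    refine @measurable_to_bool _ (_) _ ?_
    refine MeasurableSpace.measurableSet_generateFrom ⟨{n}, ?_⟩
    ext f; simp [boolCylinder]
  · refine MeasurableSpace.generateFrom_le ?_
    rintro _ ⟨s, rfl⟩
    exact measurableSet_boolCylinder_empty s

lemma isPiSystem_boolCylinder_empty :
    IsPiSystem (range fun s : Finset ℕ => boolCylinder s ∅) := by
  classical
  rintro _ ⟨s, rfl⟩ _ ⟨t, rfl⟩ _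
  refine ⟨s ∪ t, ?_⟩
  ext f
  simp only [boolCylinder, mem_ofPred_eq, mem_inter_iff, Finset.mem_union, Finset.notMem_empty]
  grind

/-- An independent sequence of sets of measure `1/2` pushes `P` to the coin-flipping measure. -/
lemma IsCoinFlipMeasure.map_itinerary {ν : Measure (ℕ → Bool)} (hν : IsCoinFlipMeasure ν)
    {Ω : Type*} [MeasurableSpace Ω] (P : Measure Ω) [IsProbabilityMeasure P] {A : ℕ → Set Ω}
    (hA : ∀ n, MeasurableSet (A n)) (hAindep : IndepFamily P A) (hAhalf : ∀ n, P (A n) = 1 / 2) :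
    P.map (itinerary A) = ν := by
  have hφ := measurable_itinerary hA
  have := hν.1
  have := Measure.isProbabilityMeasure_map (μ := P) hφ.aemeasurable
  refine ext_of_generate_finite _ generateFrom_boolCylinder_empty
    isPiSystem_boolCylinder_empty ?_ (by simp)
  rintro _ ⟨s, rfl⟩
  have hpre : itinerary A ⁻¹' boolCylinder s ∅ = ⋂ n ∈ s, A n := by
    ext ω; simp [boolCylinder, itinerary]
  have hcyl : boolCylinder s ∅ = {f | ∀ n ∈ s, f n = (fun _ => true) n} := by
    ext f; simp [boolCylinder]
  beta_reduce
  rw [Measure.map_apply hφ (measurableSet_boolCylinder_empty s), hpre, hAindep s, hcyl, hν.2 s]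
  simp [hAhalf]

lemma exists_mem_boolCylinder_subset {U : Set (ℕ → Bool)} (hU : IsOpen U) {f : ℕ → Bool}
    (hf : f ∈ U) : ∃ s t, f ∈ boolCylinder s t ∧ boolCylinder s t ⊆ U := by
  obtain ⟨I, u, hu, hIU⟩ := isOpen_pi_iff.1 hU f hf
  refine ⟨I.filter (f · = true), I.filter (f · = false), by simp [boolCylinder], ?_⟩
  intro g hg
  refine hIU fun n hn => ?_
  have hgf : g n = f n := by
    simp only [boolCylinder, Finset.mem_filter, mem_ofPred_eq] at hg
    cases h : f n
    · exact hg.2 n ⟨hn, h⟩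
    · exact hg.1 n ⟨hn, h⟩
  rw [hgf]
  exact (hu n hn).2

lemma IsClosed.eq_iInter_compl_boolCylinder {K : Set (ℕ → Bool)} (hK : IsClosed K) :
    K = ⋂ p : {p : Finset ℕ × Finset ℕ // boolCylinder p.1 p.2 ⊆ Kᶜ},
      (boolCylinder p.1.1 p.1.2)ᶜ := by
  ext f
  simp only [mem_iInter]
  refine ⟨fun hf p hp => p.2 hp hf, fun h => ?_⟩
  by_contra hf
  obtain ⟨s, t, hfst, hst⟩ := exists_mem_boolCylinder_subset hK.isOpen_compl hf
  exact h ⟨(s, t), hst⟩ hfst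

lemma biInter_finset_mem {Ω ι : Type*} {S0 : Set (Set Ω)} (huniv : Set.univ ∈ S0)
    (hinter : ∀ A ∈ S0, ∀ B ∈ S0, A ∩ B ∈ S0) {A : ι → Set Ω} (hA : ∀ i, A i ∈ S0)
    (s : Finset ι) : (⋂ i ∈ s, A i) ∈ S0 := by
  classical
  induction s using Finset.induction_on with
  | empty => simpa using huniv
  | insert a s _ ih =>
    rw [Finset.set_biInter_insert]
    exact hinter _ (hA a) _ ih

lemma itinerary_preimage_boolCylinder_mem {Ω : Type*} {S0 : Set (Set Ω)}
    (huniv : Set.univ ∈ S0) (hinter : ∀ A ∈ S0, ∀ B ∈ S0, A ∩ B ∈ S0)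
    (hcompl : ∀ A ∈ S0, Aᶜ ∈ S0) {A : ℕ → Set Ω} (hA : ∀ n, A n ∈ S0) (s t : Finset ℕ) :
    itinerary A ⁻¹' boolCylinder s t ∈ S0 := by
  have : itinerary A ⁻¹' boolCylinder s t = (⋂ n ∈ s, A n) ∩ ⋂ n ∈ t, (A n)ᶜ := by
    ext ω; simp [boolCylinder, itinerary]
  rw [this]
  exact hinter _ (biInter_finset_mem huniv hinter hA s) _
    (biInter_finset_mem huniv hinter (fun n => hcompl _ (hA n)) t)

/-- Inside `E ∩ φ⁻¹ K` with `K` closed there is a member of the algebra of full measure. -/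
lemma exists_mem_subset_inter_itinerary_preimage {Ω : Type*} [MeasurableSpace Ω] {P : Measure Ω}
    {S0 : Set (Set Ω)} (huniv : Set.univ ∈ S0) (hinter : ∀ A ∈ S0, ∀ B ∈ S0, A ∩ B ∈ S0)
    (hcompl : ∀ A ∈ S0, Aᶜ ∈ S0)
    (hcap : ∀ A : ℕ → Set Ω, (∀ n, A n ∈ S0) →
      ∃ B ∈ S0, B ⊆ (⋂ n, A n) ∧ P B = P (⋂ n, A n))
    {A : ℕ → Set Ω} (hA : ∀ n, A n ∈ S0) {K : Set (ℕ → Bool)} (hK : IsClosed K)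
    {E : Set Ω} (hE : E ∈ S0) :
    ∃ B ∈ S0, B ⊆ E ∩ itinerary A ⁻¹' K ∧ P B = P (E ∩ itinerary A ⁻¹' K) := by
  let J := Option {p : Finset ℕ × Finset ℕ // boolCylinder p.1 p.2 ⊆ Kᶜ}
  let G : J → Set Ω := fun j =>
    j.elim E fun p => (itinerary A ⁻¹' boolCylinder p.1.1 p.1.2)ᶜ
  have hG : ∀ j, G j ∈ S0
    | none => hE
    | some p => hcompl _ (itinerary_preimage_boolCylinder_mem huniv hinter hcompl hA _ _)
  obtain ⟨e, he⟩ := exists_surjective_nat J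
  have hinterG : ⋂ n, G (e n) = E ∩ itinerary A ⁻¹' K := by
    rw [he.iInter_comp G, iInter_option]
    conv_rhs => rw [hK.eq_iInter_compl_boolCylinder]
    simp [G, preimage_iInter]
  obtain ⟨B, hB, hsub, hP⟩ := hcap (fun n => G (e n)) fun n => hG _
  exact ⟨B, hB, hinterG ▸ hsub, hinterG ▸ hP⟩

lemma measure_compl_le_inv_of_lt {X : Type*} [MeasurableSpace X] {ν : Measure X}
    [IsProbabilityMeasure ν] {K : Set X} (hK : MeasurableSet K) {n : ℕ}
    (h : (n : ℝ≥0∞) / ((n : ℝ≥0∞) + 1) < ν K) : ν Kᶜ ≤ ((n : ℝ≥0∞) + 1)⁻¹ := by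
  rw [prob_compl_eq_one_sub hK, tsub_le_iff_left]
  refine le_trans (le_of_eq ?_) (add_le_add_left h.le _)
  rw [div_eq_mul_inv, ← add_one_mul, ENNReal.mul_inv_cancel (by simp) (by finiteness)]

lemma le_of_forall_le_add_inv_nat {a b : ℝ≥0∞} (h : ∀ n : ℕ, a ≤ b + ((n : ℝ≥0∞) + 1)⁻¹) :
    a ≤ b := by
  refine ENNReal.le_of_forall_pos_le_add fun ε hε _ => ?_
  obtain ⟨n, hn⟩ := ENNReal.exists_inv_nat_lt (a := (ε : ℝ≥0∞)) (by simpa using hε.ne')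
  refine (h n).trans (add_le_add_right (le_trans ?_ hn.le) _)
  exact ENNReal.inv_le_inv.2 le_self_add

/-- A family of sets indexed by `ι × ℕ` which is saturated for subfamilies of cardinality `< κ` is
compact if its members are mapped into closed sets of a compact space, each point of which meets
fewer than `κ` many of the indices. -/
lemma isCompactFamily_range_of_maps_to {X : Type*} [TopologicalSpace X] [CompactSpace X]
    {κ : Cardinal.{u}} (hκ : Cardinal.aleph0 < κ) {ι Ω : Type u} {φ : Ω → X}
    {C : ι → ℕ → Set X} (hCclosed : ∀ α n, IsClosed (C α n))
    (hCwit : ∀ f : X, Cardinal.mk {α : ι | ∃ n, f ∈ C α n} < κ)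
    {B : ι → ℕ → Set Ω} (hB : ∀ α n, B α n ⊆ φ ⁻¹' C α n)
    (hsat : ∀ D ⊆ range (Function.uncurry B), Cardinal.mk D < κ → HasFIP D → (⋂₀ D).Nonempty) :
    IsCompactFamily (range (Function.uncurry B)) := by
  classical
  intro D hD hfip
  choose p hp using fun d : D => hD d.2
  have hne : (⋂ d : D, C (p d).1 (p d).2).Nonempty := by
    refine CompactSpace.iInter_nonempty (fun d => hCclosed _ _) fun s => ?_
    obtain ⟨ω, hω⟩ := hfip (s.image (↑)) (by simp)
    refine ⟨φ ω, mem_iInter₂.2 fun d hd => hB _ _ ?_⟩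
    have : ω ∈ (d : Set Ω) := hω d (by simpa using hd)
    rwa [← hp d] at this
  obtain ⟨f, hf⟩ := hne
  rw [mem_iInter] at hf
  refine hsat D hD ?_ hfip
  have hinj : Function.Injective
      (fun d : D => ((⟨(p d).1, (p d).2, hf d⟩, (p d).2) : {α : ι | ∃ n, f ∈ C α n} × ℕ)) := by
    intro d d' h
    simp only [Prod.mk.injEq, Subtype.mk.injEq] at h
    exact Subtype.ext (by rw [← hp d, ← hp d', Prod.ext h.1 h.2])
  calc Cardinal.mk D ≤ Cardinal.mk ({α : ι | ∃ n, f ∈ C α n} × ℕ) :=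
        Cardinal.mk_le_of_injective hinj
    _ = Cardinal.mk {α : ι | ∃ n, f ∈ C α n} * Cardinal.aleph0 := by simp
    _ < κ := Cardinal.mul_lt_of_lt hκ.le (hCwit f) hκ

/-- **Theorem 2 of Jin–Shelah.** If there is a `(κ,λ)`-witness for uncountable
cardinals `κ, λ`, and `(Ω, S0, P)` is a probability space with an algebra `S0`
of measurable sets of cardinality `λ` such that `P` is inner regular with
respect to `S0`, countable intersections of members of `S0` are approximated
in measure from inside by members of `S0`, `S0` is `κ`-saturated, and `S0`
contains an independent sequence of sets of measure `1/2`, then `(Ω, S0, P)` is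
compact in the sense of Ross, with an inner-regular compact family consisting
of members of `S0`. -/
theorem loeb_compact_of_witness
    (ν : Measure (ℕ → Bool)) (hν : IsCoinFlipMeasure ν)
    (κ lam : Cardinal.{u}) (hκ : Cardinal.aleph0 < κ) (hlam : Cardinal.aleph0 < lam)
    -- the (κ,λ)-witness
    (C : lam.out → ℕ → Set (ℕ → Bool))
    (hCclosed : ∀ α n, IsClosed (C α n))
    (hCbig : ∀ (α : lam.out) (n : ℕ), (n : ℝ≥0∞) / ((n : ℝ≥0∞) + 1) < ν (C α n))
    (hCwit : ∀ f : ℕ → Bool, Cardinal.mk {α : lam.out | ∃ n, f ∈ C α n} < κ)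
    -- the probability space and the algebra S0
    {Ω : Type u} [MeasurableSpace Ω] (P : Measure Ω) [IsProbabilityMeasure P]
    (S0 : Set (Set Ω))
    (hmeas : ∀ A ∈ S0, MeasurableSet A)
    (huniv : Set.univ ∈ S0)
    (hunion : ∀ A ∈ S0, ∀ B ∈ S0, A ∪ B ∈ S0)
    (hinter : ∀ A ∈ S0, ∀ B ∈ S0, A ∩ B ∈ S0)
    (hcompl : ∀ A ∈ S0, Aᶜ ∈ S0)
    (hcard : Cardinal.mk S0 = lam)
    -- (i) inner regularity with respect to S0
    (hinner : ∀ A : Set Ω, MeasurableSet A →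
      P A = ⨆ (B : Set Ω) (_ : B ∈ S0 ∧ B ⊆ A), P B)
    -- (ii) countable intersections are approximated from inside
    (hcap : ∀ A : ℕ → Set Ω, (∀ n, A n ∈ S0) →
      ∃ B ∈ S0, B ⊆ (⋂ n, A n) ∧ P B = P (⋂ n, A n))
    -- (iii) κ-saturation
    (hsat : ∀ D ⊆ S0, Cardinal.mk D < κ → HasFIP D → (⋂₀ D).Nonempty)
    -- (iv) an independent sequence of measure 1/2 in S0
    (A : ℕ → Set Ω) (hAS0 : ∀ n, A n ∈ S0) (hAindep : IndepFamily P A)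
    (hAhalf : ∀ n, P (A n) = 1 / 2) :
    ∃ C' : Set (Set Ω), C' ⊆ S0 ∧ IsInnerRegularFamily P C' ∧ IsCompactFamily C' := by
  have hAmeas n := hmeas _ (hAS0 n)
  have hφ := measurable_itinerary hAmeas
  have hmap := hν.map_itinerary P hAmeas hAindep hAhalf
  have := hν.1
  obtain ⟨e⟩ : Nonempty (lam.out ≃ S0) := Cardinal.eq.1 (by rw [Cardinal.mk_out, hcard])
  choose B hBS0 hBsub hBP using fun (α : lam.out) (n : ℕ) =>
    exists_mem_subset_inter_itinerary_preimage huniv hinter hcompl hcap hAS0 (hCclosed α n) (e α).2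
  have hrange : range (Function.uncurry B) ⊆ S0 := by
    rintro _ ⟨p, rfl⟩
    exact hBS0 _ _
  refine ⟨range (Function.uncurry B), hrange, fun M hM => le_antisymm ?_ ?_,
    isCompactFamily_range_of_maps_to hκ hCclosed hCwit
      (fun α n => (hBsub α n).trans inter_subset_right)
      fun D hD => hsat D (hD.trans hrange)⟩
  · rw [hinner M hM]
    refine iSup₂_le fun E hE => le_of_forall_le_add_inv_nat fun n => ?_
    obtain ⟨α, hα⟩ := e.surjective ⟨E, hE.1⟩
    have hB := hBsub α n
    have hP := hBP α n
    simp only [hα] at hB hP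
    have hC := (hCclosed α n).measurableSet
    calc P E ≤ P (E ∩ itinerary A ⁻¹' C α n) + P (itinerary A ⁻¹' (C α n)ᶜ) := by
          refine (measure_mono fun ω hω => ?_).trans (measure_union_le _ _)
          by_cases h : itinerary A ω ∈ C α n
          · exact Or.inl ⟨hω, h⟩
          · exact Or.inr h
      _ = P (B α n) + ν (C α n)ᶜ := by rw [hP, ← hmap, Measure.map_apply hφ hC.compl]
      _ ≤ _ := add_le_add
          (le_iSup₂_of_le (B α n) ⟨⟨(α, n), rfl⟩, (hB.trans inter_subset_left).trans hE.2⟩ le_rfl)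
          (measure_compl_le_inv_of_lt hC (hCbig α n))
  · exact iSup₂_le fun E hE => measure_mono hE.2
end

section
/- Assume the Continuum Hypothesis (2^{ℵ₀} = ℵ₁). Then there exists an (ω₁, ω₁)-witness: a family (C_{α,n})_{α<ω₁, n∈ℕ} of closed subsets of Cantor space 2^ℕ such that ν(C_{α,n}) > n/(n+1) for all α < ω₁ and n ∈ ℕ, and for every f ∈ 2^ℕ the set {α < ω₁ : ∃n ∈ ℕ, f ∈ C_{α,n}} is countable. (The combinatorial core of the paper's Corollary 3.) -/
open MeasureTheory Set
open scoped ENNReal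

namespace IsCoinFlipMeasure

/-- The coin-flipping measure gives every point measure zero. -/
theorem nullSingletonClass {ν : Measure (ℕ → Bool)} (hν : IsCoinFlipMeasure ν) :
    NullSingletonClass ν := by
  refine ⟨fun g => le_antisymm (ge_of_tendsto'
    (ENNReal.tendsto_pow_atTop_nhds_zero_of_lt_one (r := 1 / 2) (by simp)) fun k => ?_)
    zero_le⟩
  have h := hν.2 (Finset.range k) g
  rw [Finset.card_range] at h
  rw [← h]
  exact measure_mono fun f hf n _ => by rw [mem_singleton_iff.1 hf]

end IsCoinFlipMeasure

/-- Every type of cardinality `ℵ₁` carries a well-order all of whose proper initial segments are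
countable. -/
theorem exists_isWellOrder_countable_initialSegments {α : Type*}
    (hα : Cardinal.mk α = Cardinal.aleph 1) :
    ∃ r : α → α → Prop, IsWellOrder α r ∧ ∀ a, {b | r b a}.Countable := by
  obtain ⟨r, hr, h⟩ := Cardinal.exists_ord_eq α
  refine ⟨r, hr, fun a => ?_⟩
  have := Cardinal.card_typein_lt a h
  rw [Ordinal.card_typein, hα, Cardinal.lt_aleph_one_iff] at this
  exact Cardinal.le_aleph0_iff_set_countable.1 this

/-- A countable set can be avoided by a closed set of measure arbitrarily close to one. -/
theorem Set.Countable.exists_isClosed_disjoint_lt_measure {X : Type*} [TopologicalSpace X]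
    [MeasurableSpace X] [BorelSpace X] [TopologicalSpace.PseudoMetrizableSpace X]
    [MeasurableSingletonClass X] (μ : Measure X) [IsProbabilityMeasure μ] [NullSingletonClass μ]
    {S : Set X} (hS : S.Countable) {c : ℝ≥0∞} (hc : c < 1) : ∃ K, IsClosed K ∧ Disjoint K S ∧ c < μ K := by
  have hm : μ Sᶜ = 1 := by
    rw [measure_compl hS.measurableSet (measure_ne_top _ _), hS.measure_zero, measure_univ,
      tsub_zero]
  obtain ⟨K, hKS, hK, hcK⟩ := hS.measurableSet.compl.exists_lt_isClosed_of_ne_top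
    (measure_ne_top μ _) (hm ▸ hc)
  exact ⟨K, hK, subset_compl_iff_disjoint_right.1 hKS, hcK⟩

/-- **Corollary 3 of Jin–Shelah (combinatorial core).** Assuming the Continuum
Hypothesis, there is an `(ω₁, ω₁)`-witness: a family `(C α n)` of closed
subsets of Cantor space, indexed by `α < ω₁` and `n ∈ ℕ`, with
`ν (C α n) > n/(n+1)` and such that each `f ∈ 2^ℕ` belongs to some `C α n`
for only countably many `α`. -/
theorem exists_omega1_witness_of_CH
    (ν : Measure (ℕ → Bool)) (hν : IsCoinFlipMeasure ν)
    (CH : Cardinal.continuum = Cardinal.aleph 1) :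
    ∃ C : (Cardinal.aleph 1).out → ℕ → Set (ℕ → Bool),
      (∀ (α : (Cardinal.aleph 1).out) (n : ℕ), IsClosed (C α n)) ∧
      (∀ (α : (Cardinal.aleph 1).out) (n : ℕ),
        (n : ℝ≥0∞) / ((n : ℝ≥0∞) + 1) < ν (C α n)) ∧
      (∀ f : ℕ → Bool, {α : (Cardinal.aleph 1).out | ∃ n, f ∈ C α n}.Countable) := by
  have := hν.1
  have := hν.nullSingletonClass
  obtain ⟨r, hr, hcount⟩ :=
    exists_isWellOrder_countable_initialSegments (Cardinal.mk_out (Cardinal.aleph 1))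
  obtain ⟨e⟩ : Nonempty ((ℕ → Bool) ≃ (Cardinal.aleph 1).out) := by
    have h₀ : Cardinal.continuum.{0} = Cardinal.aleph 1 :=
      Cardinal.lift_eq_aleph_one.1 (Cardinal.lift_continuum.trans CH)
    rw [← Cardinal.lift_mk_eq', Cardinal.mk_out]
    simpa using Cardinal.lift_continuum.symm.trans (Cardinal.lift_eq_aleph_one.2 h₀)
  have hlt (n : ℕ) : (n : ℝ≥0∞) / ((n : ℝ≥0∞) + 1) < 1 := by
    rw [ENNReal.div_lt_iff (by simp) (by simp), one_mul]
    exact ENNReal.lt_add_right (by simp) (by simp)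
  have hS (α : (Cardinal.aleph 1).out) : (e ⁻¹' {β | ¬ r α β}).Countable := by
    refine Countable.preimage_of_injOn (((hcount α).insert α).mono fun β hβ => ?_) e.injective.injOn
    rcases trichotomous_of r α β with h | h | h
    exacts [absurd h hβ, Or.inl h.symm, Or.inr h]
  choose C hclosed hdisj hmeas using fun α n =>
    (hS α).exists_isClosed_disjoint_lt_measure ν (hlt n)
  refine ⟨C, hclosed, hmeas, fun f => (hcount (e f)).mono ?_⟩
  rintro α ⟨n, hf⟩
  by_contra h
  exact disjoint_left.1 (hdisj α n) hf h
end

section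
/- Fix n ∈ ℕ and f ∈ 2^ℕ. Let 𝒯_n be the set of all finite trees t ⊆ 2^{<ω} (downward-closed sets of finite binary sequences) such that t = {η ∈ T : |η| ≤ m} for some m ∈ ℕ and some tree T ⊆ 2^{<ω} without maximal nodes satisfying ν([T]) > (n+1)/(n+2). Then the set D_f = {t ∈ 𝒯_n : t has height m for some m ∈ ℕ and f↾m ∉ t} is dense in 𝒯_n with respect to end-extension: for every t ∈ 𝒯_n there exist m ∈ ℕ and t' ∈ 𝒯_n such that t' end-extends t, t' has height m, and f↾m ∉ t'. (The paper's Claim 5.1.) -/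
open MeasureTheory Set
open scoped ENNReal

/-- The initial segment `f↾m` of `f : ℕ → Bool` of length `m`, as a finite
binary sequence. -/
def seg (f : ℕ → Bool) (m : ℕ) : List Bool := (List.range m).map f

/-- A set of finite binary sequences is a tree if it is closed under initial
segments. -/
def IsTree (T : Set (List Bool)) : Prop :=
  ∀ η ∈ T, ∀ σ : List Bool, σ <+: η → σ ∈ T

/-- A tree has no maximal nodes if every node has a proper extension in the
tree. -/
def NoMaximalNode (T : Set (List Bool)) : Prop :=
  ∀ η ∈ T, ∃ η' ∈ T, η <+: η' ∧ η' ≠ η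

/-- `[T]`, the set of infinite branches of the tree `T`. -/
def branches (T : Set (List Bool)) : Set (ℕ → Bool) :=
  {f | ∀ m : ℕ, seg f m ∈ T}

/-- `T↾m = {η ∈ T : |η| ≤ m}`. -/
def restrictTree (T : Set (List Bool)) (m : ℕ) : Set (List Bool) :=
  {η ∈ T | η.length ≤ m}

/-- `t'` end-extends `t`: `t = {η ∈ t' : |η| ≤ m₀}` where `m₀` is a height
of `t`. -/
def EndExtends (t' t : Set (List Bool)) : Prop :=
  ∃ m₀ : ℕ, (∀ η ∈ t, η.length ≤ m₀) ∧ t = restrictTree t' m₀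

/-- The forcing notion `𝒯 n`: all finite trees of the form `T↾m` where `T` is
a tree without maximal nodes whose set of branches has `ν`-measure greater
than `(n+1)/(n+2)`. -/
def TreeForcing (ν : Measure (ℕ → Bool)) (n : ℕ) : Set (Set (List Bool)) :=
  {t | ∃ (T : Set (List Bool)) (m : ℕ), IsTree T ∧ NoMaximalNode T ∧
    ((n : ℝ≥0∞) + 1) / ((n : ℝ≥0∞) + 2) < ν (branches T) ∧ t = restrictTree T m}

@[simp]
theorem length_seg (f : ℕ → Bool) (m : ℕ) : (seg f m).length = m := by simp [seg]

theorem getElem_seg (f : ℕ → Bool) (m i : ℕ) (h : i < (seg f m).length) :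
    (seg f m)[i] = f i := by simp [seg]

theorem eq_of_seg_prefix_seg {f g : ℕ → Bool} {k j : ℕ} (h : seg f k <+: seg g j) {i : ℕ}
    (hi : i < k) : g i = f i := by
  have := h.getElem (i := i) (by simpa using hi)
  rw [getElem_seg, getElem_seg] at this
  exact this.symm

/-- The sequences that agree with a node of `T` up to length `m₀` and are otherwise free, except
that they do not extend `σ`. -/
def freeTreeAvoiding (T : Set (List Bool)) (m₀ : ℕ) (σ : List Bool) : Set (List Bool) :=
  {η | η.take m₀ ∈ T ∧ ¬ σ <+: η}

theorem isTree_freeTreeAvoiding {T : Set (List Bool)} (hT : IsTree T) (m₀ : ℕ)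
    (σ : List Bool) : IsTree (freeTreeAvoiding T m₀ σ) :=
  fun _ hη _ hτ => ⟨hT _ hη.1 _ (hτ.take m₀), fun h => hη.2 (h.trans hτ)⟩

theorem noMaximalNode_freeTreeAvoiding {T : Set (List Bool)} (hT : IsTree T)
    (hmax : NoMaximalNode T) {m₀ : ℕ} {σ : List Bool} (hσ : m₀ < σ.length) :
    NoMaximalNode (freeTreeAvoiding T m₀ σ) := by
  rintro η ⟨hη, hησ⟩
  rcases lt_or_ge η.length m₀ with hlt | hge
  · rw [List.take_of_length_le hlt.le] at hη
    obtain ⟨η', hη', hpre, hne⟩ := hmax η hη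
    have hlen : η.length < η'.length :=
      lt_of_le_of_ne hpre.length_le fun h => hne (hpre.eq_of_length h).symm
    refine ⟨η'.take m₀, ⟨?_, fun h => ?_⟩, ?_, fun h => ?_⟩
    · rw [List.take_take, min_self]
      exact hT _ hη' _ (List.take_prefix _ _)
    · have := h.length_le
      rw [List.length_take] at this
      omega
    · exact List.prefix_take_iff.2 ⟨hpre, hlt.le⟩
    · have := congrArg List.length h
      rw [List.length_take] at this
      omega
  · refine ⟨η ++ [!(σ.getD η.length false)], ⟨?_, fun h => ?_⟩, List.prefix_append _ _, by simp⟩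
    · rwa [List.take_append_of_le_length hge]
    · rcases List.prefix_concat_iff.1 h with h | h
      · have := congrArg (fun l => l.getD η.length false) h
        simp at this
      · exact hησ h

theorem diff_cylinder_subset_branches (T : Set (List Bool)) (hT : IsTree T) (m₀ : ℕ)
    (f : ℕ → Bool) (k : ℕ) :
    branches T \ {g | ∀ i ∈ Finset.range k, g i = f i} ⊆
      branches (freeTreeAvoiding T m₀ (seg f k)) := by
  rintro g ⟨hg, hgf⟩ j
  refine ⟨hT _ (hg j) _ (List.take_prefix _ _), fun h => hgf fun i hi => ?_⟩
  exact eq_of_seg_prefix_seg h (Finset.mem_range.1 hi)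

theorem restrictTree_freeTreeAvoiding (T : Set (List Bool)) {m₀ : ℕ} {σ : List Bool}
    (hσ : m₀ < σ.length) :
    restrictTree (freeTreeAvoiding T m₀ σ) m₀ = restrictTree T m₀ := by
  ext η
  refine and_congr_left fun hlen => ?_
  change η.take m₀ ∈ T ∧ ¬ σ <+: η ↔ η ∈ T
  rw [List.take_of_length_le hlen]
  exact and_iff_left fun h => by have := h.length_le; omega

theorem restrictTree_restrictTree (T : Set (List Bool)) {m k : ℕ} (h : m ≤ k) :
    restrictTree (restrictTree T k) m = restrictTree T m := by
  ext η
  exact ⟨fun hη => ⟨hη.1.1, hη.2⟩, fun hη => ⟨⟨hη.1, hη.2.trans h⟩, hη.2⟩⟩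

/-- **Claim 5.1 of Jin–Shelah.** For fixed `n ∈ ℕ` and `f ∈ 2^ℕ`, the set
`D_f = {t ∈ 𝒯 n : t has height m and f↾m ∉ t for some m}` is dense in `𝒯 n`
with respect to end-extension. -/
theorem treeForcing_dense
    (ν : Measure (ℕ → Bool)) (hν : IsCoinFlipMeasure ν)
    (n : ℕ) (f : ℕ → Bool) (t : Set (List Bool)) (ht : t ∈ TreeForcing ν n) :
    ∃ (m : ℕ) (t' : Set (List Bool)), t' ∈ TreeForcing ν n ∧
      EndExtends t' t ∧
      (∀ η ∈ t', η.length ≤ m) ∧ (∃ η ∈ t', η.length = m) ∧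
      seg f m ∉ t' := by
  obtain ⟨T, m₀, hT, hmax, hlt, rfl⟩ := ht
  have hpow := ENNReal.tendsto_pow_atTop_nhds_zero_of_lt_one (r := 1 / 2)
    (by rw [one_div]; exact ENNReal.one_half_lt_one)
  obtain ⟨k, hk, hmk⟩ := ((hpow.eventually_lt_const (tsub_pos_of_lt hlt)).and
    (Filter.eventually_gt_atTop m₀)).exists
  have hσ : m₀ < (seg f k).length := by simpa using hmk
  have hcyl := hν.2 (Finset.range k) f
  rw [Finset.card_range] at hcyl
  have hmeas : ((n : ℝ≥0∞) + 1) / ((n : ℝ≥0∞) + 2) <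
      ν (branches (freeTreeAvoiding T m₀ (seg f k))) := by
    refine lt_of_lt_of_le ?_
      (le_measure_sdiff.trans (measure_mono (diff_cylinder_subset_branches T hT m₀ f k)))
    rw [hcyl]
    exact lt_tsub_comm.1 hk
  obtain ⟨g, hg⟩ := nonempty_of_measure_ne_zero (pos_of_gt hmeas).ne'
  refine ⟨k, restrictTree (freeTreeAvoiding T m₀ (seg f k)) k,
    ⟨_, k, isTree_freeTreeAvoiding hT _ _, noMaximalNode_freeTreeAvoiding hT hmax hσ, hmeas, rfl⟩,
    ⟨m₀, fun η hη => hη.2, ?_⟩, fun η hη => hη.2,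
    ⟨seg g k, ⟨hg k, (length_seg g k).le⟩, length_seg g k⟩,
    fun h => h.1.2 List.prefix_rfl⟩
  rw [restrictTree_restrictTree _ hmk.le, restrictTree_freeTreeAvoiding T hσ]
end

section
/- Let κ be a strong limit cardinal of cofinality ω and let λ = κ⁺ = 2^κ. Let (Ω, Σ, P) be a probability space and let Σ₀ ⊆ Σ be an algebra of measurable subsets of Ω with |Σ₀| ≤ λ such that: (i) P is inner regular with respect to Σ₀; (ii) for every sequence (A_n)_{n∈ℕ} of members of Σ₀ there exists B ∈ Σ₀ with B ⊆ ⋂_{n∈ℕ} A_n and P(B) = P(⋂_{n∈ℕ} A_n); (iii) (λ-saturation) every subfamily of Σ₀ of cardinality < λ with the finite intersection property has nonempty intersection; (iv) there exists an independent family (A_α)_{α<κ} of members of Σ₀ with P(A_α) = 1/2 for every α < κ. Then (Ω, Σ, P) is compact in the sense of Ross. (Paper's Theorem 8, with the properties of the Loeb space and the λ-saturated nonstandard universe that the proof uses stated as explicit hypotheses.) -/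
open MeasureTheory Set
open scoped ENNReal

theorem Cardinal.mk_Iic_toType_ord_lt {c : Cardinal.{u}} (hc : Cardinal.aleph0 ≤ c)
    (i : c.ord.ToType) : Cardinal.mk (Iic i) < c := by
  have hIio : Cardinal.mk (Iio i) < c := by simpa using Cardinal.mk_Iio_lt i (by simp)
  rw [← Iio_insert]
  exact (Cardinal.mk_insert_le).trans_lt
    (Cardinal.add_lt_of_lt hc hIio (Cardinal.one_lt_aleph0.trans_le hc))

/-- A set of size at most a cardinal `κ` of countable cofinality is a countable union of
sets of size less than `κ`. -/
theorem exists_countable_cover_of_cof_eq_aleph0 {κ : Cardinal.{u}}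
    (hcof : κ.ord.cof = Cardinal.aleph0) {T : Type u} {X : Set T} (hX : Cardinal.mk X ≤ κ) :
    ∃ Y : ℕ → Set T, (∀ x ∈ X, ∃ m, x ∈ Y m) ∧ ∀ m, Cardinal.mk (Y m) < κ := by
  have hκ : Cardinal.aleph0 ≤ κ := hcof ▸ Ordinal.cof_ord_le κ
  obtain ⟨S, hS, hScard⟩ := Order.exists_cof_eq κ.ord.ToType
  rw [Ordinal.cof_toType, hcof] at hScard
  have hScount : S.Countable := Cardinal.le_aleph0_iff_set_countable.1 hScard.le
  have hSne : S.Nonempty := by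
    rw [nonempty_iff_ne_empty]
    rintro rfl
    rw [Cardinal.mk_eq_zero] at hScard
    exact Cardinal.aleph0_ne_zero hScard.symm
  obtain ⟨f, rfl⟩ := hScount.exists_eq_range hSne
  have hX' : Cardinal.mk X ≤ Cardinal.mk κ.ord.ToType := by simpa using hX
  obtain ⟨j⟩ := Cardinal.le_def _ _ |>.1 hX'
  refine ⟨fun m ↦ Subtype.val '' (j ⁻¹' Iic (f m)), fun x hx ↦ ?_, fun m ↦ ?_⟩
  · obtain ⟨_, ⟨m, rfl⟩, hm⟩ := hS (j ⟨x, hx⟩)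
    exact ⟨m, ⟨x, hx⟩, hm, rfl⟩
  · exact Cardinal.mk_image_le.trans_lt
      ((Cardinal.mk_preimage_of_injective _ _ j.injective).trans_lt
        (Cardinal.mk_Iic_toType_ord_lt hκ _))

/-- Fewer than `κ` subsets of a set of size `κ`, `κ` a strong limit, are all constant on a
common infinite set. -/
theorem exists_infinite_forall_constant {κ : Cardinal.{u}} (hsl : κ.IsStrongLimit) {I : Type u}
    [Infinite I] (hI : Cardinal.mk I = κ) {Y : Set (Set I)} (hY : Cardinal.mk Y < κ) :
    ∃ J : Set I, J.Infinite ∧ ∀ x ∈ Y, J ⊆ x ∨ J ⊆ xᶜ := by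
  have hlt : Cardinal.mk (Set Y) < Cardinal.mk I := by
    rw [Cardinal.mk_set, hI]
    exact hsl.isStrongPrelimit hY
  obtain ⟨t, ht⟩ := Cardinal.exists_infinite_fiber (fun i : I ↦ {x : Y | i ∈ x.1}) hlt
  refine ⟨_, infinite_coe_iff.1 ht, fun x hx ↦ ?_⟩
  by_cases hxt : (⟨x, hx⟩ : Y) ∈ t
  · left
    rintro i rfl
    exact hxt
  · right
    rintro i rfl
    exact hxt

/-- The set of points at which the membership in `A i` is the same for all `i ∈ F`. -/
def agreementSet {Ω I : Type*} (A : I → Set Ω) (F : Finset I) : Set Ω :=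
  (⋂ i ∈ F, A i) ∪ ⋂ i ∈ F, (A i)ᶜ

theorem IndepFamily.measure_agreementSet_le {Ω I : Type*} [MeasurableSpace Ω] {P : Measure Ω}
    [IsProbabilityMeasure P] {A : I → Set Ω} (hA : IndepFamily P A)
    (hmeas : ∀ i, MeasurableSet (A i)) (hhalf : ∀ i, P (A i) = 1 / 2) (F : Finset I) :
    P (agreementSet A F) ≤ 2 * 2⁻¹ ^ F.card := by
  have hind := (ProbabilityTheory.iIndepSet_iff_iIndep A P).1
    ((ProbabilityTheory.iIndepSet_iff_meas_biInter hmeas).2 hA)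
  have hcompl : P (⋂ i ∈ F, (A i)ᶜ) = ∏ i ∈ F, P (A i)ᶜ :=
    hind.meas_biInter fun i _ ↦
      (MeasurableSpace.measurableSet_generateFrom (mem_singleton (A i))).compl
  refine (measure_union_le _ _).trans ?_
  rw [hcompl, hA F]
  simp [measure_compl (hmeas _), hhalf, two_mul]

theorem biInter_mem_of_mem {Ω I : Type*} {S : Set (Set Ω)} (huniv : univ ∈ S)
    (hinter : ∀ A ∈ S, ∀ B ∈ S, A ∩ B ∈ S) {A : I → Set Ω} (hA : ∀ i, A i ∈ S)
    (F : Finset I) : ⋂ i ∈ F, A i ∈ S := by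
  classical
  induction F using Finset.induction_on with
  | empty => simpa using huniv
  | insert a s _ ih =>
    rw [Finset.set_biInter_insert]
    exact hinter _ (hA a) _ ih

/-- Every member of `S0` can be shrunk by an arbitrarily small amount so as to avoid the fibres
of the `A i` over a given set `X` of at most `κ` points of `2 ^ κ`. -/
theorem exists_subset_disjoint_agreementSet {κ : Cardinal.{u}} (hsl : κ.IsStrongLimit)
    (hcof : κ.ord.cof = Cardinal.aleph0) {Ω : Type u} [MeasurableSpace Ω] {P : Measure Ω}
    [IsProbabilityMeasure P] {S0 : Set (Set Ω)} (hmeas : ∀ A ∈ S0, MeasurableSet A)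
    (huniv : univ ∈ S0) (hunion : ∀ A ∈ S0, ∀ B ∈ S0, A ∪ B ∈ S0)
    (hinter : ∀ A ∈ S0, ∀ B ∈ S0, A ∩ B ∈ S0) (hcompl : ∀ A ∈ S0, Aᶜ ∈ S0)
    (hcap : ∀ A : ℕ → Set Ω, (∀ n, A n ∈ S0) →
      ∃ B ∈ S0, B ⊆ (⋂ n, A n) ∧ P B = P (⋂ n, A n))
    {I : Type u} (hI : Cardinal.mk I = κ) {A : I → Set Ω} (hAS : ∀ i, A i ∈ S0)
    (hAindep : IndepFamily P A) (hAhalf : ∀ i, P (A i) = 1 / 2)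
    {X : Set (Set I)} (hX : Cardinal.mk X ≤ κ) {B : Set Ω} (hB : B ∈ S0)
    {ε : ℝ≥0∞} (hε : ε ≠ 0) :
    ∃ C ∈ S0, C ⊆ B ∧ P B ≤ P C + ε ∧ ∀ x ∈ X, ∃ F : Finset I,
      ((F : Set I) ⊆ x ∨ (F : Set I) ⊆ xᶜ) ∧ Disjoint C (agreementSet A F) := by
  have hinf : Infinite I := by
    rw [Cardinal.infinite_iff, hI, ← hcof]
    exact Ordinal.cof_ord_le κ
  obtain ⟨Y, hXY, hY⟩ := exists_countable_cover_of_cof_eq_aleph0 hcof hX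
  obtain ⟨δ, hδ, hδsum⟩ := ENNReal.exists_pos_sum_of_countable' hε ℕ
  have hF : ∀ m, ∃ F : Finset I, (∀ x ∈ Y m, (F : Set I) ⊆ x ∨ (F : Set I) ⊆ xᶜ) ∧
      P (agreementSet A F) ≤ δ m := by
    intro m
    obtain ⟨J, hJ, hJY⟩ := exists_infinite_forall_constant hsl hI (hY m)
    obtain ⟨k, hk⟩ := ENNReal.exists_inv_two_pow_lt (a := δ m / 2)
      (ENNReal.div_pos (hδ m).ne' (by simp)).ne'
    obtain ⟨F, hFJ, hFcard⟩ := hJ.exists_subset_card_eq k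
    refine ⟨F, fun x hx ↦ (hJY x hx).imp hFJ.trans hFJ.trans,
      (hAindep.measure_agreementSet_le (fun i ↦ hmeas _ (hAS i)) hAhalf F).trans ?_⟩
    rw [hFcard]
    calc 2 * 2⁻¹ ^ k ≤ 2 * (δ m / 2) := by gcongr
      _ = δ m := ENNReal.mul_div_cancel (by simp) (by simp)
  choose F hFY hFδ using hF
  have hG : ∀ m, agreementSet A (F m) ∈ S0 := fun m ↦
    hunion _ (biInter_mem_of_mem huniv hinter hAS _) _
      (biInter_mem_of_mem huniv hinter (fun i ↦ hcompl _ (hAS i)) _)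
  obtain ⟨C, hC, hCsub, hCP⟩ := hcap (fun m ↦ B ∩ (agreementSet A (F m))ᶜ)
    fun m ↦ hinter _ hB _ (hcompl _ (hG m))
  rw [subset_iInter_iff] at hCsub
  refine ⟨C, hC, (hCsub 0).trans inter_subset_left, ?_, fun x hx ↦ ?_⟩
  · rw [hCP, ← inter_iInter]
    calc P B ≤ P ((B ∩ ⋂ m, (agreementSet A (F m))ᶜ) ∪ ⋃ m, agreementSet A (F m)) := by
          refine measure_mono fun ω hω ↦ ?_
          by_cases h : ω ∈ ⋃ m, agreementSet A (F m)
          · exact Or.inr h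
          · exact Or.inl ⟨hω, by simpa using h⟩
      _ ≤ P (B ∩ ⋂ m, (agreementSet A (F m))ᶜ) + P (⋃ m, agreementSet A (F m)) :=
          measure_union_le _ _
      _ ≤ _ := by
          gcongr
          exact (measure_iUnion_le _).trans ((ENNReal.tsum_le_tsum hFδ).trans hδsum.le)
  · obtain ⟨m, hm⟩ := hXY x hx
    exact ⟨F m, hFY m x hm,
      disjoint_compl_left.mono_left ((hCsub m).trans inter_subset_right)⟩

/-- **Theorem 8 of Jin–Shelah.** Let `κ` be a strong limit cardinal of
cofinality `ω` and `λ = κ⁺ = 2^κ`. If `(Ω, Σ, P)` is a probability space with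
an algebra `S0` of measurable sets of cardinality at most `λ` such that `P` is
inner regular with respect to `S0`, countable intersections of members of `S0`
are approximated in measure from inside by members of `S0`, `S0` is
`λ`-saturated, and `S0` contains an independent `κ`-family of sets of measure
`1/2`, then `(Ω, Σ, P)` is compact in the sense of Ross. -/
theorem loeb_compact_of_strong_limit_succ
    (κ lam : Cardinal.{u})
    (hsl : κ.IsStrongLimit) (hcof : κ.ord.cof = Cardinal.aleph0)
    (hsucc : lam = Order.succ κ) (hpow : lam = 2 ^ κ)
    {Ω : Type u} [MeasurableSpace Ω] (P : Measure Ω) [IsProbabilityMeasure P]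
    (S0 : Set (Set Ω))
    (hmeas : ∀ A ∈ S0, MeasurableSet A)
    (huniv : Set.univ ∈ S0)
    (hunion : ∀ A ∈ S0, ∀ B ∈ S0, A ∪ B ∈ S0)
    (hinter : ∀ A ∈ S0, ∀ B ∈ S0, A ∩ B ∈ S0)
    (hcompl : ∀ A ∈ S0, Aᶜ ∈ S0)
    (hcard : Cardinal.mk S0 ≤ lam)
    -- (i) inner regularity with respect to S0
    (hinner : ∀ A : Set Ω, MeasurableSet A →
      P A = ⨆ (B : Set Ω) (_ : B ∈ S0 ∧ B ⊆ A), P B)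
    -- (ii) countable intersections are approximated from inside
    (hcap : ∀ A : ℕ → Set Ω, (∀ n, A n ∈ S0) →
      ∃ B ∈ S0, B ⊆ (⋂ n, A n) ∧ P B = P (⋂ n, A n))
    -- (iii) λ-saturation
    (hsat : ∀ D ⊆ S0, Cardinal.mk D < lam → HasFIP D → (⋂₀ D).Nonempty)
    -- (iv) an independent κ-family of sets of measure 1/2 in S0
    (A : κ.out → Set Ω) (hAS : ∀ α, A α ∈ S0) (hAindep : IndepFamily P A)
    (hAhalf : ∀ α, P (A α) = 1 / 2) :
    RossCompact P := by
  have hκ : Cardinal.aleph0 ≤ κ := hcof ▸ Ordinal.cof_ord_le κ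
  have hlam : Cardinal.aleph0 ≤ lam := hκ.trans (hsucc ▸ Order.le_succ κ)
  have hle_of_lt : ∀ {c : Cardinal.{u}}, c < lam → c ≤ κ := fun h ↦
    Order.lt_succ_iff.1 (hsucc ▸ h)
  -- Rank the members of `S0` and the points of `2 ^ κ` along `lam`.
  have hr : Cardinal.mk S0 ≤ Cardinal.mk lam.ord.ToType := by simpa using hcard
  have hs : Cardinal.mk (Set κ.out) ≤ Cardinal.mk lam.ord.ToType := by simp [hpow]
  obtain ⟨r⟩ := Cardinal.le_def _ _ |>.1 hr
  obtain ⟨s⟩ := Cardinal.le_def _ _ |>.1 hs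
  have hX : ∀ a : S0, Cardinal.mk {x | s x < r a} ≤ κ := fun a ↦ hle_of_lt <|
    (Cardinal.mk_le_mk_of_subset
      (preimage_mono (f := s) (Iio_subset_Iic_self (a := r a)))).trans_lt <|
      (Cardinal.mk_preimage_of_injective s (Iic (r a)) s.injective).trans_lt
        (Cardinal.mk_Iic_toType_ord_lt hlam _)
  have hC := fun (a : S0) (n : ℕ) ↦ exists_subset_disjoint_agreementSet hsl hcof hmeas huniv
    hunion hinter hcompl hcap κ.mk_out hAS hAindep hAhalf (hX a) a.2
    (ENNReal.inv_ne_zero.2 (ENNReal.natCast_ne_top (n + 1)))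
  choose C hCS hCsub hCP hCX using hC
  refine ⟨range fun p : S0 × ℕ ↦ C p.1 p.2, ?_, fun E hE ↦ le_antisymm ?_ ?_, fun D hD hfip ↦ ?_⟩
  · rintro _ ⟨p, rfl⟩
    exact hmeas _ (hCS _ _)
  · rw [hinner E hE]
    refine iSup₂_le fun B hB ↦ ge_of_tendsto' (f := fun n : ℕ ↦
      (⨆ (B : Set Ω) (_ : B ∈ range (fun p : S0 × ℕ ↦ C p.1 p.2) ∧ B ⊆ E), P B) +
        ((n + 1 : ℕ) : ℝ≥0∞)⁻¹) (x := Filter.atTop) ?_ fun n ↦ ?_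
    · have h := (Filter.tendsto_add_atTop_iff_nat 1).2 ENNReal.tendsto_inv_nat_nhds_zero
      simpa using h.const_add
        (⨆ (B : Set Ω) (_ : B ∈ range (fun p : S0 × ℕ ↦ C p.1 p.2) ∧ B ⊆ E), P B)
    · refine (hCP ⟨B, hB.1⟩ n).trans (add_le_add_left ?_ _)
      exact le_iSup₂_of_le (C ⟨B, hB.1⟩ n)
        ⟨⟨(⟨B, hB.1⟩, n), rfl⟩, (hCsub ⟨B, hB.1⟩ n).trans hB.2⟩ le_rfl
  · exact iSup₂_le fun B hB ↦ measure_mono hB.2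
  · refine hsat D (hD.trans ?_) ?_ hfip
    · rintro _ ⟨p, rfl⟩
      exact hCS _ _
    have hne : (Filter.generate D).NeBot := Filter.generate_neBot_iff.2 fun t ht hfin ↦ by
      simpa using hfip hfin.toFinset (by simpa using ht)
    let U : Ultrafilter Ω := Ultrafilter.of (Filter.generate D)
    have hDU : ∀ B ∈ D, B ∈ U := fun B hB ↦
      Ultrafilter.of_le _ (Filter.mem_generate_of_mem hB)
    let x : Set κ.out := {i | A i ∈ U}
    -- A member of `D` coming from a set of rank above that of `x` would miss a member of `U`.
    have hrank : D ⊆ (fun p : S0 × ℕ ↦ C p.1 p.2) '' ((r ⁻¹' Iic (s x)) ×ˢ univ) := by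
      intro B hB
      obtain ⟨⟨a, n⟩, rfl⟩ := hD hB
      refine ⟨(a, n), ⟨?_, mem_univ _⟩, rfl⟩
      by_contra hax
      have hlt : s x < r a := not_le.1 hax
      obtain ⟨F, hFx, hdisj⟩ := hCX a n x hlt
      have hmem : agreementSet A F ∈ U := by
        rcases hFx with h | h
        · exact Filter.mem_of_superset
            ((Filter.biInter_finset_mem F).2 fun i hi ↦ h hi) subset_union_left
        · exact Filter.mem_of_superset
            ((Filter.biInter_finset_mem F).2 fun i hi ↦ Ultrafilter.compl_mem_iff_notMem.2 (h hi))
            subset_union_right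
      have hempty := Filter.inter_mem (hDU _ hB) hmem
      rw [hdisj.inter_eq] at hempty
      exact U.empty_notMem hempty
    refine (Cardinal.mk_le_mk_of_subset hrank).trans_lt (Cardinal.mk_image_le.trans_lt ?_)
    have hprod : Cardinal.mk ((r ⁻¹' Iic (s x)) ×ˢ (univ : Set ℕ)) =
        Cardinal.mk (r ⁻¹' Iic (s x)) * Cardinal.aleph0 := by
      rw [Cardinal.mk_congr (Equiv.Set.prod _ _)]
      simp
    rw [hprod]
    have hseg : Cardinal.mk (r ⁻¹' Iic (s x)) ≤ κ := hle_of_lt <|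
      (Cardinal.mk_preimage_of_injective r _ r.injective).trans_lt
        (Cardinal.mk_Iic_toType_ord_lt hlam _)
    calc Cardinal.mk (r ⁻¹' Iic (s x)) * Cardinal.aleph0 ≤ κ * κ := mul_le_mul' hseg hκ
      _ = κ := Cardinal.mul_eq_self hκ
      _ < lam := hsucc ▸ Order.lt_succ κ
end

section
/- Let λ be a regular cardinal such that κ^{ℵ₀} < λ for every cardinal κ < λ. Let (Ω, Σ, P) be a probability space with |Ω| = λ that carries an independent family (A_α)_{α<λ} of measurable sets with P(A_α) = 1/2 for every α < λ. Then (Ω, Σ, P) is not compact in the sense of Ross. (Paper's Theorem 9; the hypothesis on the independent family is Fact 3 for hyperfinite Loeb spaces of cardinality λ, stated explicitly so that the result applies to any such probability space.) -/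
open MeasureTheory Set
open scoped ENNReal

universe u

/-- Every sequence in the well-order of type `ω₁` is strictly bounded. -/
theorem exists_forall_lt_of_seq_aleph_one (f : ℕ → (Cardinal.aleph.{u} 1).ord.ToType) :
    ∃ i, ∀ n, f n < i := by
  by_contra! h
  have hcover : (univ : Set (Cardinal.aleph.{u} 1).ord.ToType) ⊆ ⋃ n, Iic (f n) := by
    intro i _
    obtain ⟨n, hn⟩ := h i
    exact mem_iUnion.2 ⟨n, hn⟩
  have hcount : (univ : Set (Cardinal.aleph.{u} 1).ord.ToType).Countable := by
    refine (countable_iUnion fun n => ?_).mono hcover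
    rw [← Iio_insert]
    refine Countable.insert _ ?_
    have := Cardinal.mk_Iio_lt (f n) (by simp)
    rw [Cardinal.mk_ord_toType] at this
    rwa [← Cardinal.le_aleph0_iff_set_countable, ← Order.lt_succ_iff, Cardinal.succ_aleph0]
  rw [← Cardinal.le_aleph0_iff_set_countable, Cardinal.mk_univ, Cardinal.mk_ord_toType] at hcount
  exact absurd hcount (not_le.2 Cardinal.aleph0_lt_aleph_one)

theorem mk_measurableSet_generateFrom_lt {lam : Cardinal.{u}} (hreg : lam.IsRegular)
    (hlam : ∀ κ : Cardinal.{u}, κ < lam → κ ^ Cardinal.aleph0 < lam)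
    {Ω : Type u} {S : Set (Set Ω)} (hS : Cardinal.mk S < lam) :
    Cardinal.mk {s | MeasurableSet[MeasurableSpace.generateFrom S] s} < lam :=
  (MeasurableSpace.cardinal_measurableSet_le S).trans_lt
    (hlam _ (max_lt hS (by exact_mod_cast hreg.nat_lt 2)))

/-- A small σ-algebra closed under a map assigning small σ-algebras to sets. -/
theorem exists_small_measurableSpace_closed {lam : Cardinal.{u}} (hreg : lam.IsRegular)
    (hlam : ∀ κ : Cardinal.{u}, κ < lam → κ ^ Cardinal.aleph0 < lam)
    {Ω : Type u} {m0 : MeasurableSpace Ω} (F : Set Ω → MeasurableSpace Ω)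
    (hF : ∀ v, F v ≤ m0) (hFcard : ∀ v, Cardinal.mk {s | MeasurableSet[F v] s} < lam) :
    ∃ m ≤ m0, Cardinal.mk {s | MeasurableSet[m] s} < lam ∧
      ∀ v, MeasurableSet[m] v → F v ≤ m := by
  let I : Type u := (Cardinal.aleph.{u} 1).ord.ToType
  have hI : Cardinal.mk I < lam := by
    rw [Cardinal.mk_ord_toType]
    calc Cardinal.aleph 1 ≤ Cardinal.continuum := Cardinal.aleph_one_le_continuum
      _ = 2 ^ Cardinal.aleph0 := Cardinal.two_power_aleph0.symm
      _ < lam := hlam _ (by exact_mod_cast hreg.nat_lt 2)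
  let T : (i : I) → ((j : I) → j < i → MeasurableSpace Ω) → Set (Set Ω) := fun i r =>
    ⋃ j : Iio i, ({s | MeasurableSet[r j j.2] s} ∪
      ⋃ v : {s | MeasurableSet[r j j.2] s}, {s | MeasurableSet[F v] s})
  let M : I → MeasurableSpace Ω :=
    WellFoundedLT.fix fun i r => MeasurableSpace.generateFrom (T i r)
  have hM : ∀ i, M i = MeasurableSpace.generateFrom (T i fun j _ => M j) := fun i =>
    WellFoundedLT.fix_eq _ i
  have hmono : ∀ {j i}, j < i → M j ≤ M i := by
    intro j i hji s hs
    rw [hM i]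
    exact MeasurableSpace.measurableSet_generateFrom (mem_iUnion.2 ⟨⟨j, hji⟩, Or.inl hs⟩)
  have hclosed : ∀ {j i}, j < i → ∀ v, MeasurableSet[M j] v → F v ≤ M i := by
    intro j i hji v hv s hs
    rw [hM i]
    exact MeasurableSpace.measurableSet_generateFrom
      (mem_iUnion.2 ⟨⟨j, hji⟩, Or.inr (mem_iUnion.2 ⟨⟨v, hv⟩, hs⟩)⟩)
  have hle : ∀ i, M i ≤ m0 := by
    intro i
    induction i using WellFoundedLT.induction with
    | ind i ih =>
      rw [hM i]
      refine MeasurableSpace.generateFrom_le fun s hs => ?_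
      obtain ⟨j, hs | hs⟩ := mem_iUnion.1 hs
      · exact ih j j.2 s hs
      · obtain ⟨v, hs⟩ := mem_iUnion.1 hs
        exact hF v s hs
  have hcard : ∀ i, Cardinal.mk {s | MeasurableSet[M i] s} < lam := by
    intro i
    induction i using WellFoundedLT.induction with
    | ind i ih =>
      rw [hM i]
      refine mk_measurableSet_generateFrom_lt hreg hlam ?_
      refine (Cardinal.card_iUnion_lt_iff_forall_of_isRegular hreg
        ((Cardinal.mk_set_le _).trans_lt hI)).2 fun j => ?_
      refine (Cardinal.mk_union_le _ _).trans_lt (Cardinal.add_lt_of_lt hreg.aleph0_le (ih j j.2) ?_)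
      exact (Cardinal.card_iUnion_lt_iff_forall_of_isRegular hreg (ih j j.2)).2 fun v => hFcard v
  have hseq : ∀ f : ℕ → I, ∃ i, ∀ n, f n < i := exists_forall_lt_of_seq_aleph_one
  let m : MeasurableSpace Ω :=
    { MeasurableSet' := fun s => ∃ i, MeasurableSet[M i] s
      measurableSet_empty := ⟨(hseq fun _ => Classical.choice
        (Cardinal.mk_ne_zero_iff.1 (by
          rw [Cardinal.mk_ord_toType]; exact (Cardinal.aleph_pos 1).ne'))).choose,
        @MeasurableSet.empty _ (M _)⟩
      measurableSet_compl := fun s ⟨i, hs⟩ => ⟨i, hs.compl⟩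
      measurableSet_iUnion := fun f hf => by
        choose g hg using hf
        obtain ⟨i, hi⟩ := hseq g
        exact ⟨i, MeasurableSet.iUnion fun n => hmono (hi n) _ (hg n)⟩ }
  refine ⟨m, fun s ⟨i, hs⟩ => hle i s hs, ?_, fun v ⟨j, hv⟩ => ?_⟩
  · have : {s | MeasurableSet[m] s} = ⋃ i, {s | MeasurableSet[M i] s} := by
      ext s
      exact mem_iUnion.symm
    rw [this]
    exact (Cardinal.card_iUnion_lt_iff_forall_of_isRegular hreg hI).2 hcard
  · obtain ⟨i, hi⟩ := hseq fun _ => j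
    exact fun s hs => ⟨i, hclosed (hi 0) v hv s hs⟩

/-- The support of an absolutely continuous measure. -/
theorem exists_measurableSet_support {Ω : Type*} [MeasurableSpace Ω] {ν μ : Measure Ω}
    [IsFiniteMeasure ν] [IsFiniteMeasure μ] (h : ν ≪ μ) :
    ∃ U, MeasurableSet U ∧ ν Uᶜ = 0 ∧
      ∀ X ⊆ U, ν X = 0 → μ X = 0 := by
  have hmeas := Measure.measurable_rnDeriv ν μ
  have hU : MeasurableSet {x | ν.rnDeriv μ x ≠ 0} := (hmeas (measurableSet_singleton 0)).compl
  refine ⟨{x | ν.rnDeriv μ x ≠ 0}, hU, ?_, fun X hXU h0 => ?_⟩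
  · rw [← Measure.withDensity_rnDeriv_eq ν μ h]
    refine (withDensity_apply_eq_zero hmeas).2 ?_
    rw [Measure.withDensity_rnDeriv_eq ν μ h, inter_compl_self, measure_empty]
  · rw [← Measure.withDensity_rnDeriv_eq ν μ h] at h0
    rw [← inter_eq_self_of_subset_right hXU]
    exact (withDensity_apply_eq_zero hmeas).1 h0

/-- The essential hull of `B` in a sub-σ-algebra `m`. -/
theorem exists_measurable_essHull {Ω : Type*} {m m0 : MeasurableSpace Ω} (hm : m ≤ m0)
    (P : Measure[m0] Ω) [IsFiniteMeasure P] (B : Set Ω) :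
    ∃ U, MeasurableSet[m] U ∧ P (B \ U) = 0 ∧
      ∀ X, MeasurableSet[m] X → X ⊆ U → P X ≠ 0 → P (X ∩ B) ≠ 0 := by
  have hν : ∀ X, MeasurableSet[m] X → (P.restrict B).trim hm X = P (X ∩ B) := fun X hX => by
    rw [trim_measurableSet_eq hm hX, Measure.restrict_apply (hm X hX)]
  have hac : (P.restrict B).trim hm ≪ P.trim hm :=
    Measure.restrict_le_self.absolutelyContinuous.trim hm
  obtain ⟨U, hU, hU0, hUX⟩ := @exists_measurableSet_support _ m _ _ _ _ hac
  refine ⟨U, hU, ?_, fun X hX hXU hP h0 => hP ?_⟩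
  · rwa [hν _ hU.compl, inter_comm, ← sdiff_eq] at hU0
  · rw [← trim_measurableSet_eq hm hX]
    exact hUX X hXU ((hν X hX).trans h0)

/-- Pairs of sets of nearly full measure in the sides of uniformly separated partitions: some
nonnull set `v` is essentially split by a pair over each small σ-algebra. -/
theorem exists_essentially_split {lam : Cardinal.{u}} (hreg : lam.IsRegular)
    (hlam : ∀ κ : Cardinal.{u}, κ < lam → κ ^ Cardinal.aleph0 < lam)
    {Ω I : Type u} [m0 : MeasurableSpace Ω] (P : Measure Ω) [IsFiniteMeasure P]
    (hI : Cardinal.mk I = lam) {A : I → Set Ω} {B : I → Bool → Set Ω} {ε : ℝ≥0∞}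
    (hsep : ∀ α β, α ≠ β → ε + ε ≤ P (A α \ A β))
    (htrue : ∀ α, P (A α \ B α true) < ε) (hfalse : ∀ α, P ((A α)ᶜ \ B α false) < ε) :
    ∃ v, P v ≠ 0 ∧ ∀ m ≤ m0, Cardinal.mk {s | MeasurableSet[m] s} < lam →
      ∃ α, ∀ X, MeasurableSet[m] X → P (X ∩ v) ≠ 0 → ∀ b, P (X ∩ v ∩ B α b) ≠ 0 := by
  by_contra! hcon
  have hbad : ∀ v, ∃ m ≤ m0, Cardinal.mk {s | MeasurableSet[m] s} < lam ∧ (P v ≠ 0 →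
      ∀ α, ∃ X, MeasurableSet[m] X ∧ P (X ∩ v) ≠ 0 ∧ ∃ b, P (X ∩ v ∩ B α b) = 0) := by
    intro v
    by_cases hv : P v = 0
    · refine ⟨MeasurableSpace.generateFrom ∅, MeasurableSpace.generateFrom_le (by simp),
        mk_measurableSet_generateFrom_lt hreg hlam ?_, fun h => absurd hv h⟩
      simpa using hreg.pos
    · obtain ⟨m, hm, hcard, h⟩ := hcon v hv
      exact ⟨m, hm, hcard, fun _ => h⟩
  choose F hF hFcard hFbad using hbad
  obtain ⟨m, hm, hmcard, hmF⟩ := exists_small_measurableSpace_closed hreg hlam F hF hFcard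
  obtain ⟨α, hα⟩ : ∃ α, ∀ C, MeasurableSet[m] C → P (A α \ C) < ε → ε ≤ P (C \ A α) := by
    by_contra! hnear
    choose C hC hC₁ hC₂ using hnear
    obtain ⟨α, β, heq, hne⟩ : ∃ α β, C α = C β ∧ α ≠ β := by
      by_contra! hinj
      have hle := Cardinal.mk_le_of_injective
        (f := fun α => (⟨C α, hC α⟩ : {s | MeasurableSet[m] s}))
        fun α β h => hinj α β (congrArg Subtype.val h)
      rw [hI] at hle
      exact absurd hmcard (not_lt.2 hle)
    have hsub : A α \ A β ⊆ (A α \ C α) ∪ (C β \ A β) := by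
      rw [← heq]
      intro x hx
      by_cases hxC : x ∈ C α
      · exact Or.inr ⟨hxC, hx.2⟩
      · exact Or.inl ⟨hx.1, hxC⟩
    refine absurd (hsep α β hne) (not_le.2 ?_)
    calc P (A α \ A β) ≤ P (A α \ C α) + P (C β \ A β) :=
          (measure_mono hsub).trans (measure_union_le _ _)
      _ < ε + ε := ENNReal.add_lt_add (hC₁ α) (hC₂ β)
  choose U hU hBU hUX using fun b => exists_measurable_essHull hm P (B α b)
  have hnear : ∀ {E : Set Ω} {b}, P (E \ B α b) < ε → P (E \ U b) < ε := by
    intro E b hE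
    refine lt_of_le_of_lt ?_ hE
    calc P (E \ U b) ≤ P ((E \ B α b) ∪ (B α b \ U b)) := measure_mono fun x hx => by
          by_cases hxB : x ∈ B α b
          · exact Or.inr ⟨hxB, hx.2⟩
          · exact Or.inl ⟨hx.1, hxB⟩
      _ ≤ P (E \ B α b) + P (B α b \ U b) := measure_union_le _ _
      _ = P (E \ B α b) := by rw [hBU, add_zero]
  have hpos : P (U true ∩ U false) ≠ 0 := by
    intro h0
    refine absurd (hα (U true) (hU true) (hnear (htrue α))) (not_le.2 ?_)
    calc P (U true \ A α) ≤ P (((A α)ᶜ \ U false) ∪ (U true ∩ U false)) :=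
          measure_mono fun x hx => by
            by_cases hxU : x ∈ U false
            · exact Or.inr ⟨hx.1, hxU⟩
            · exact Or.inl ⟨hx.2, hxU⟩
      _ ≤ P ((A α)ᶜ \ U false) + P (U true ∩ U false) := measure_union_le _ _
      _ = P ((A α)ᶜ \ U false) := by rw [h0, add_zero]
      _ < ε := hnear (hfalse α)
  have hv : MeasurableSet[m] (U true ∩ U false) := (hU true).inter (hU false)
  obtain ⟨X, hX, hXv, b, hXb⟩ := hFbad _ hpos α
  refine hUX b _ ((hmF _ hv X hX).inter hv) (fun x hx => ?_) hXv hXb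
  cases b
  · exact hx.2.2
  · exact hx.2.1

/-- A subfamily, indexed by a well-order of type `lam`, whose finite Boolean choices are nonnull. -/
theorem exists_measure_independent_pairs {lam : Cardinal.{u}} (hreg : lam.IsRegular)
    (hlam : ∀ κ : Cardinal.{u}, κ < lam → κ ^ Cardinal.aleph0 < lam)
    {Ω I : Type u} [m0 : MeasurableSpace Ω] (P : Measure Ω) [IsFiniteMeasure P]
    (hI : Cardinal.mk I = lam) {A : I → Set Ω} {B : I → Bool → Set Ω} {ε : ℝ≥0∞}
    (hsep : ∀ α β, α ≠ β → ε + ε ≤ P (A α \ A β))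
    (hB : ∀ α b, MeasurableSet (B α b))
    (htrue : ∀ α, P (A α \ B α true) < ε) (hfalse : ∀ α, P ((A α)ᶜ \ B α false) < ε) :
    ∃ a : lam.ord.ToType → I, ∀ (f : lam.ord.ToType → Bool) (s : Finset lam.ord.ToType),
      P (⋂ i ∈ s, B (a i) (f i)) ≠ 0 := by
  obtain ⟨v, hv, hsplit⟩ := exists_essentially_split hreg hlam P hI hsep htrue hfalse
  let T : (i : lam.ord.ToType) → ((j : lam.ord.ToType) → j < i → I) → Set (Set Ω) := fun i r =>
    range fun p : Iio i × Bool => B (r p.1 p.1.2) p.2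
  have hT : ∀ i r, ∃ α, ∀ X, MeasurableSet[MeasurableSpace.generateFrom (T i r)] X →
      P (X ∩ v) ≠ 0 → ∀ b, P (X ∩ v ∩ B α b) ≠ 0 := by
    intro i r
    refine hsplit _ (MeasurableSpace.generateFrom_le ?_)
      (mk_measurableSet_generateFrom_lt hreg hlam (Cardinal.mk_range_le.trans_lt ?_))
    · rintro _ ⟨p, rfl⟩
      exact hB _ _
    · rw [Cardinal.mk_prod, Cardinal.lift_uzero, Cardinal.mk_bool, Cardinal.lift_ofNat]
      exact Cardinal.mul_lt_of_lt hreg.aleph0_le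
        (by simpa using Cardinal.mk_Iio_lt i (by simp)) (by exact_mod_cast hreg.nat_lt 2)
  choose g hg using hT
  let a : lam.ord.ToType → I := WellFoundedLT.fix g
  have ha : ∀ i, a i = g i fun j _ => a j := fun i => WellFoundedLT.fix_eq _ i
  refine ⟨a, fun f s => ?_⟩
  have key : P ((⋂ i ∈ s, B (a i) (f i)) ∩ v) ≠ 0 := by
    induction s using Finset.induction_on_max with
    | empty => simpa using hv
    | insert i s hs ih =>
      rw [Finset.set_biInter_insert, inter_assoc, inter_comm, ha i]
      refine hg i _ _ ?_ ih (f i)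
      refine Finset.measurableSet_biInter s fun j hj => ?_
      exact MeasurableSpace.measurableSet_generateFrom ⟨(⟨j, hs j hj⟩, f j), rfl⟩
  exact fun h0 => key (measure_mono_null inter_subset_left h0)

theorem IsInnerRegularFamily.exists_diff_lt {Ω : Type*} [MeasurableSpace Ω] {P : Measure Ω}
    [IsFiniteMeasure P] {C : Set (Set Ω)} (hC : IsInnerRegularFamily P C)
    (hCmeas : ∀ B ∈ C, MeasurableSet B) {A : Set Ω} (hA : MeasurableSet A) {ε : ℝ≥0∞}
    (hε : ε ≠ 0) (hPA : P A ≠ 0) : ∃ B ∈ C, B ⊆ A ∧ P (A \ B) < ε := by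
  have hlt : P A - ε < ⨆ (B : Set Ω) (_ : B ∈ C ∧ B ⊆ A), P B := by
    rw [← hC A hA]
    exact ENNReal.sub_lt_self (measure_ne_top P A) hPA hε
  simp only [lt_iSup_iff] at hlt
  obtain ⟨B, ⟨hBC, hBA⟩, hlt⟩ := hlt
  refine ⟨B, hBC, hBA, ?_⟩
  rw [measure_sdiff hBA (hCmeas B hBC).nullMeasurableSet (measure_ne_top P B)]
  exact ENNReal.sub_lt_of_lt_add (measure_mono hBA) (by
    rw [add_comm]; exact ENNReal.lt_add_of_sub_lt_right (Or.inl (measure_ne_top P A)) hlt)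

theorem IndepFamily.measure_diff_eq {Ω I : Type*} [MeasurableSpace Ω] {P : Measure Ω}
    [IsFiniteMeasure P] {A : I → Set Ω} (hA : IndepFamily P A)
    (hAmeas : ∀ i, MeasurableSet (A i)) (hAhalf : ∀ i, P (A i) = 1 / 2) {i j : I} (hij : i ≠ j) :
    P (A i \ A j) = 1 / 8 + 1 / 8 := by
  classical
  have hinter : P (A i ∩ A j) = 1 / 2 * (1 / 2) := by
    have := hA {i, j}
    rwa [Finset.set_biInter_insert, Finset.set_biInter_singleton, Finset.prod_pair hij,
      hAhalf, hAhalf] at this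
  have hadd := measure_inter_add_sdiff (μ := P) (A i) (hAmeas j)
  rw [hinter, hAhalf] at hadd
  rw [← ENNReal.toReal_eq_toReal_iff' (measure_ne_top _ _) (by finiteness)]
  have hreal := congrArg ENNReal.toReal hadd
  rw [ENNReal.toReal_add (by finiteness) (measure_ne_top _ _)] at hreal
  rw [ENNReal.toReal_add (by finiteness) (by finiteness)]
  simp at hreal ⊢
  linarith

/-- **Theorem 9 of Jin–Shelah.** Let `λ` be a regular cardinal with
`κ^ℵ₀ < λ` for every `κ < λ`. If `(Ω, Σ, P)` is a probability space of
cardinality `λ` carrying an independent `λ`-family of measurable sets of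
measure `1/2`, then `(Ω, Σ, P)` is not compact in the sense of Ross. -/
theorem not_rossCompact_of_regular
    (lam : Cardinal.{u}) (hreg : lam.IsRegular)
    (hlam : ∀ κ : Cardinal.{u}, κ < lam → κ ^ Cardinal.aleph0 < lam)
    {Ω : Type u} [MeasurableSpace Ω] (P : Measure Ω) [IsProbabilityMeasure P]
    (hΩ : Cardinal.mk Ω = lam)
    (A : lam.out → Set Ω) (hAmeas : ∀ α, MeasurableSet (A α))
    (hAindep : IndepFamily P A) (hAhalf : ∀ α, P (A α) = 1 / 2) :
    ¬ RossCompact P := by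
  rintro ⟨C, hCmeas, hCreg, hCcpt⟩
  have h8 : (1 / 8 : ℝ≥0∞) ≠ 0 := by simp
  have hcompl : ∀ α, P (A α)ᶜ ≠ 0 := fun α => by
    rw [prob_compl_eq_one_sub (hAmeas α), hAhalf, one_div, ENNReal.one_sub_inv_two]
    simp
  choose Bt hBtC hBtA hBt using fun α =>
    hCreg.exists_diff_lt hCmeas (hAmeas α) h8 (by simp [hAhalf])
  choose Bf hBfC hBfA hBf using fun α =>
    hCreg.exists_diff_lt hCmeas (hAmeas α).compl h8 (hcompl α)
  let B : lam.out → Bool → Set Ω := fun α b => cond b (Bt α) (Bf α)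
  have hBC : ∀ α b, B α b ∈ C := fun α b => by cases b; exacts [hBfC α, hBtC α]
  obtain ⟨a, ha⟩ := exists_measure_independent_pairs hreg hlam P (Cardinal.mk_out lam)
    (B := B) (fun α β h => (hAindep.measure_diff_eq hAmeas hAhalf h).ge)
    (fun α b => hCmeas _ (hBC α b)) hBt hBf
  have hpoint : ∀ f : lam.ord.ToType → Bool, (⋂₀ range fun i => B (a i) (f i)).Nonempty := by
    classical
    intro f
    refine hCcpt _ (by rintro _ ⟨i, rfl⟩; exact hBC _ _) fun F hF => ?_
    obtain ⟨s, rfl⟩ : ∃ s : Finset lam.ord.ToType, s.image (fun i => B (a i) (f i)) = F := by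
      rw [← image_univ] at hF
      obtain ⟨s, -, hs⟩ := Finset.subset_set_image_iff.1 hF
      exact ⟨s, hs⟩
    rw [Finset.coe_image, sInter_image]
    exact nonempty_of_measure_ne_zero (ha f s)
  choose p hp using hpoint
  have hmem : ∀ f i, p f ∈ A (a i) ↔ f i = true := by
    intro f i
    have h : p f ∈ B (a i) (f i) := hp f _ ⟨i, rfl⟩
    cases hfi : f i <;> rw [hfi] at h
    · simpa using hBfA _ h
    · simpa using hBtA _ h
  have hinj : Function.Injective p := fun f g hfg => funext fun i => by
    rw [Bool.eq_iff_iff, ← hmem f i, ← hmem g i, hfg]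
  have hle := Cardinal.mk_le_of_injective hinj
  simp only [hΩ, Cardinal.mk_pi, Cardinal.mk_bool, Cardinal.prod_const, Cardinal.lift_ofNat,
    Cardinal.lift_uzero, Cardinal.mk_ord_toType] at hle
  exact absurd (Cardinal.cantor lam) (not_lt.2 hle)
end

section
/- Let λ be a regular cardinal such that κ^{ℵ₀} < λ for every cardinal κ < λ. Let (Ω, Σ, P) be a probability space and let (A_α)_{α<λ} be an independent family of measurable sets with P(A_α) = 1/2 for all α. For each α < λ, n ∈ ℕ and l ∈ {0,1}, let X^l_{α,n} be a measurable set with X^l_{α,n} ⊆ A^l_α and P(⋃_{n∈ℕ} X^l_{α,n}) = 1/2. Then there exist a set E ⊆ λ with |E| = λ and natural numbers n(α,l) for each α ∈ E and l ∈ {0,1} such that for every m ∈ ℕ, every choice of distinct α₀, …, α_{m−1} ∈ E, and every h : {0,…,m−1} → {0,1}, one has P(⋂_{i<m} X^{h(i)}_{α_i, n(α_i, h(i))}) > 0. (Paper's Claim 9.1.) -/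
open MeasureTheory Set
open scoped ENNReal

/-- For a set `A`, `A^0 = A` and `A^1 = Ω ∖ A`; we index the two sides by
`Bool`, with `false ↦ A` and `true ↦ Aᶜ`. -/
def side {Ω : Type*} (A : Set Ω) : Bool → Set Ω
  | false => A
  | true => Aᶜ

open Cardinal in
theorem Ordinal.exists_forall_le_of_countable {K : Type*} [Countable K] {a : Ordinal.{u}}
    (ha : ℵ₀ < a.cof) {c : K → Ordinal.{u}} (hc : ∀ k, c k < a) : ∃ b < a, ∀ k, c k ≤ b := by
  refine ⟨⨆ k, c k, lift_iSup_lt_of_lt_cof ?_ hc, Ordinal.le_iSup c⟩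
  rw [← Ordinal.lift_cof]
  exact (lift_le_aleph0.2 mk_le_aleph0).trans_lt (aleph0_lt_lift.2 ha)

open Cardinal in
/-- A pressing-down principle: a function that is regressive at the ordinals of uncountable
cofinality below a regular cardinal `c > ℵ₁` is bounded on `c` many of them. -/
theorem Cardinal.IsRegular.exists_card_regressive_le {c : Cardinal.{u}} (hc : c.IsRegular)
    (hc₁ : ℵ₁ < c) {ι : Type u} (hι : #ι = c) (o : ι → Ordinal.{u})
    (ho : range o = Iio c.ord) (γ : ι → Ordinal.{u}) (hγ : ∀ i, ℵ₀ < (o i).cof → γ i < o i) :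
    ∃ δ < c.ord, #{i | ℵ₀ < (o i).cof ∧ γ i ≤ δ} = c := by
  by_contra! hne
  have hlt : ∀ δ < c.ord, #{i | ℵ₀ < (o i).cof ∧ γ i ≤ δ} < c := fun δ hδ =>
    lt_of_le_of_ne (hι ▸ mk_set_le _) (hne δ hδ)
  let b : Ordinal.{u} → Ordinal.{u} := fun δ =>
    ⨆ i : {i | ℵ₀ < (o i).cof ∧ γ i ≤ δ}, o i + 1
  have hb : ∀ δ < c.ord, b δ < c.ord := fun δ hδ => by
    refine Ordinal.iSup_add_one_lt_of_lt_cof (by simpa [hc.cof_ord] using hlt δ hδ) fun i => ?_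
    exact ho.subset (mem_range_self i.1)
  have hω : Order.IsSuccLimit (Ordinal.omega 1) := Cardinal.isSuccLimit_omega 1
  have hω_lt : Ordinal.omega.{u} 1 < c.ord := by
    rw [← ord_aleph]; exact ord_lt_ord.2 hc₁
  have hc₀ : c ≠ ℵ₀ := (aleph0_lt_aleph_one.trans hc₁).ne'
  obtain ⟨i, hi⟩ : Ordinal.deriv b (Ordinal.omega 1) ∈ range o :=
    ho ▸ deriv_lt_ord hc hc₀ hb hω_lt
  have hcof : ℵ₀ < (o i).cof := by
    rw [hi, Ordinal.cof_map_of_isNormal (Ordinal.isNormal_deriv b) hω,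
      isRegular_aleph_one.cof_omega_eq]
    exact aleph0_lt_aleph_one
  have hlim := hγ i hcof
  rw [hi, (Ordinal.isNormal_deriv b).lt_iff_exists_lt hω] at hlim
  obtain ⟨ξ, hξ, hlim⟩ := hlim
  have h₁ : o i < b (Ordinal.deriv b ξ + 1) := by
    rw [← Order.add_one_le_iff]
    exact Ordinal.le_iSup (fun j : {j | ℵ₀ < (o j).cof ∧ γ j ≤ Ordinal.deriv b ξ + 1} => o j + 1)
      ⟨i, hcof, hlim.le.trans le_self_add⟩
  have h₂ : b (Ordinal.deriv b ξ + 1) ≤ Ordinal.deriv b (ξ + 1) := by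
    rw [Ordinal.deriv_add_one]
    exact Ordinal.iterate_le_nfp b _ 1
  have h₃ : Ordinal.deriv b (ξ + 1) < o i := by
    rw [hi]
    exact Ordinal.deriv_strictMono b (hω.add_one_lt hξ)
  exact (h₁.trans_le h₂).not_gt h₃

theorem measurable_of_forall_rat_Iio {Ω : Type*} {m : MeasurableSpace Ω} {f : Ω → ℝ}
    (hf : ∀ q : ℚ, MeasurableSet[m] (f ⁻¹' Iio (q : ℝ))) : Measurable[m] f := by
  rw [BorelSpace.measurable_eq (α := ℝ), Real.borel_eq_generateFrom_Iio_rat]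
  refine @measurable_generateFrom _ _ _ _ _ fun t ht => ?_
  obtain ⟨q, hq⟩ := mem_iUnion.1 ht
  exact mem_singleton_iff.1 hq ▸ hf q

/-- The σ-algebra generated by the sets `X i j` whose index `i` has rank `o i < δ`. -/
abbrev sigmaBelow {Ω ι J : Type*} (o : ι → Ordinal.{u}) (X : ι → J → Set Ω) (δ : Ordinal.{u}) :
    MeasurableSpace Ω :=
  MeasurableSpace.generateFrom {s | ∃ i j, o i < δ ∧ X i j = s}

section sigmaBelow

variable {Ω ι J : Type*} {o : ι → Ordinal.{u}} {X : ι → J → Set Ω}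

theorem sigmaBelow_mono : Monotone (sigmaBelow o X) := fun _ _ h =>
  MeasurableSpace.generateFrom_mono fun _ ⟨i, j, hi, hs⟩ => ⟨i, j, hi.trans_le h, hs⟩

theorem sigmaBelow_le [m : MeasurableSpace Ω] (hX : ∀ i j, MeasurableSet (X i j))
    (δ : Ordinal.{u}) : sigmaBelow o X δ ≤ m :=
  MeasurableSpace.generateFrom_le fun _ ⟨i, j, _, hs⟩ => hs ▸ hX i j

theorem measurableSet_sigmaBelow {i : ι} {δ : Ordinal.{u}} (hi : o i < δ) (j : J) :
    MeasurableSet[sigmaBelow o X δ] (X i j) :=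
  MeasurableSpace.measurableSet_generateFrom ⟨i, j, hi, rfl⟩

open Cardinal in
theorem exists_lt_measurableSet_sigmaBelow {a : Ordinal.{u}} (ha : ℵ₀ < a.cof) {s : Set Ω}
    (hs : MeasurableSet[sigmaBelow o X a] s) : ∃ δ < a, MeasurableSet[sigmaBelow o X δ] s := by
  have hlim : Order.IsSuccLimit a := Ordinal.one_lt_cof_iff.1 (one_lt_aleph0.trans ha)
  induction s, hs using MeasurableSpace.generateFrom_induction with
  | hC t ht _ =>
    obtain ⟨i, j, hi, rfl⟩ := ht
    exact ⟨o i + 1, hlim.add_one_lt hi, measurableSet_sigmaBelow (Order.lt_add_one_iff.2 le_rfl) j⟩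
  | empty => exact ⟨0, hlim.bot_lt, @MeasurableSet.empty _ (_)⟩
  | compl t _ ih =>
    obtain ⟨δ, hδ, h⟩ := ih
    exact ⟨δ, hδ, h.compl⟩
  | iUnion f _ ih =>
    choose c hc h using ih
    obtain ⟨δ, hδ, hle⟩ := Ordinal.exists_forall_le_of_countable ha hc
    exact ⟨δ, hδ, MeasurableSet.iUnion fun n => sigmaBelow_mono (hle n) _ (h n)⟩

open Cardinal in
theorem exists_lt_measurable_sigmaBelow [Countable J] {a : Ordinal.{u}} (ha : ℵ₀ < a.cof)
    {f : J → Ω → ℝ} (hf : ∀ j, Measurable[sigmaBelow o X a] (f j)) :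
    ∃ δ < a, ∀ j, Measurable[sigmaBelow o X δ] (f j) := by
  have key : ∀ k : J × ℚ, ∃ δ < a, MeasurableSet[sigmaBelow o X δ] (f k.1 ⁻¹' Iio (k.2 : ℝ)) :=
    fun k => exists_lt_measurableSet_sigmaBelow ha (hf k.1 measurableSet_Iio)
  choose c hc h using key
  obtain ⟨δ, hδ, hle⟩ := Ordinal.exists_forall_le_of_countable ha hc
  exact ⟨δ, hδ, fun j => measurable_of_forall_rat_Iio fun q =>
    sigmaBelow_mono (hle (j, q)) _ (h (j, q))⟩

end sigmaBelow

open Cardinal in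
theorem mk_measurableSet_sigmaBelow_lt {c : Cardinal.{u}} (hc₀ : ℵ₀ < c)
    (hc : ∀ κ < c, κ ^ ℵ₀ < c) {Ω ι : Type u} {J : Type} [Countable J] {o : ι → Ordinal.{u}}
    (ho : Function.Injective o) {X : ι → J → Set Ω} {δ : Ordinal.{u}} (hδ : δ < c.ord) :
    #{s | MeasurableSet[sigmaBelow o X δ] s} < c := by
  refine (MeasurableSpace.cardinal_measurableSet_le _).trans_lt (hc _ (max_lt ?_ ?_))
  · let f : {i | o i < δ} × ULift.{u} J → Set Ω := fun p => X p.1 p.2.down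
    have hsub : {s | ∃ i j, o i < δ ∧ X i j = s} ⊆ range f := by
      rintro _ ⟨i, j, hi, rfl⟩
      exact ⟨(⟨i, hi⟩, ⟨j⟩), rfl⟩
    refine ((mk_le_mk_of_subset hsub).trans mk_range_le).trans_lt ?_
    rw [mk_prod, lift_id, lift_id]
    refine mul_lt_of_lt hc₀.le ?_ (mk_le_aleph0.trans_lt hc₀)
    refine lt_of_le_of_lt ?_ (lt_ord.1 hδ)
    rw [← mk_toType δ]
    refine mk_le_of_injective (f := fun i => Ordinal.ToType.mk ⟨o i.1, i.2⟩) fun i j hij => ?_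
    exact Subtype.ext (ho (congrArg Subtype.val (Ordinal.ToType.mk.injective hij)))
  · exact (natCast_lt_aleph0 (n := 2)).trans hc₀

open Cardinal in
/-- If for each `i` in a set of regular cardinality `c` we are given countably many functions
measurable for one and the same small σ-algebra, then `c` many of these sequences coincide. -/
theorem exists_card_eq_of_measurable_sigmaBelow {c : Cardinal.{u}} (hreg : c.IsRegular)
    (hc₀ : ℵ₀ < c) (hc : ∀ κ < c, κ ^ ℵ₀ < c) {Ω ι : Type u} {J : Type} [Countable J]
    {o : ι → Ordinal.{u}} (ho : Function.Injective o) {X : ι → J → Set Ω} {δ : Ordinal.{u}}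
    (hδ : δ < c.ord) (g : ι → J → Ω → ℝ) {S : Set ι} (hS : c ≤ #S)
    (hg : ∀ i ∈ S, ∀ j, Measurable[sigmaBelow o X δ] (g i j)) :
    ∃ T ⊆ S, c ≤ #T ∧ ∀ i ∈ T, ∀ k ∈ T, g i = g k := by
  let code : S → (ULift.{u} (J × ℚ) → {s | MeasurableSet[sigmaBelow o X δ] s}) := fun i k =>
    ⟨g i k.down.1 ⁻¹' Iio (k.down.2 : ℝ), hg i i.2 _ measurableSet_Iio⟩
  obtain ⟨a, T, hTS, hT, ha⟩ := infinite_pigeonhole_set code c hS hc₀.le (by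
    rw [hreg.cof_ord, ← power_def]
    refine lt_of_le_of_lt ?_ (hc _ (max_lt (mk_measurableSet_sigmaBelow_lt (X := X) hc₀ hc ho hδ)
      (one_lt_aleph0.trans hc₀)))
    refine (power_le_power_right (le_max_left _ 1)).trans
      (power_le_power_left (zero_lt_one.trans_le (le_max_right _ _)).ne' mk_le_aleph0))
  refine ⟨T, hTS, hT, fun i hi k hk => funext fun j => funext fun x => ?_⟩
  have hcode : ∀ q : ℚ, g i j x < q ↔ g k j x < q := fun q => by
    have := congrArg Subtype.val (congrFun ((ha hi).trans (ha hk).symm) ⟨(j, q)⟩)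
    exact Set.ext_iff.1 this x
  by_contra hne
  rcases lt_or_gt_of_ne hne with h | h
  · obtain ⟨q, h₁, h₂⟩ := exists_rat_btwn h
    exact h₂.not_gt ((hcode q).1 h₁)
  · obtain ⟨q, h₁, h₂⟩ := exists_rat_btwn h
    exact h₂.not_gt ((hcode q).2 h₁)

section condExp

variable {Ω : Type*} {m m₀ : MeasurableSpace Ω} {P : Measure Ω} [IsFiniteMeasure P]
  {X D : Set Ω}

theorem setIntegral_condExp_indicator_one (hm : m ≤ m₀) (hX : MeasurableSet X)
    (hD : MeasurableSet[m] D) :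
    ∫ x in D, (P[X.indicator (1 : Ω → ℝ) | m]) x ∂P = P.real (X ∩ D) := by
  rw [setIntegral_condExp hm ((integrable_const 1).indicator hX) hD, integral_indicator_one hX,
    measureReal_restrict_apply hX]

theorem measure_inter_pos_of_condExp_indicator_pos (hm : m ≤ m₀) (hX : MeasurableSet X)
    (hD : MeasurableSet[m] D) (hpos : ∀ x ∈ D, 0 < (P[X.indicator (1 : Ω → ℝ) | m]) x)
    (hPD : 0 < P D) : 0 < P (X ∩ D) := by
  have hint : 0 < ∫ x in D, (P[X.indicator (1 : Ω → ℝ) | m]) x ∂P := by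
    rw [setIntegral_pos_iff_support_of_nonneg_ae
      ((ae_restrict_iff' (hm _ hD)).2 (.of_forall fun x hx => (hpos x hx).le))
      integrable_condExp.integrableOn]
    have hsupp : D ⊆ Function.support (P[X.indicator (1 : Ω → ℝ) | m]) :=
      fun x hx => (hpos x hx).ne'
    rwa [inter_eq_self_of_subset_right hsupp]
  rw [setIntegral_condExp_indicator_one hm hX hD] at hint
  exact (ENNReal.toReal_pos_iff.1 hint).1

theorem measure_inter_eq_zero_of_condExp_indicator_nonpos (hm : m ≤ m₀) (hX : MeasurableSet X)
    (hD : MeasurableSet[m] D) (hle : ∀ x ∈ D, (P[X.indicator (1 : Ω → ℝ) | m]) x ≤ 0) :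
    P (X ∩ D) = 0 := by
  have hint := setIntegral_nonpos (μ := P) (hm _ hD) hle
  rw [setIntegral_condExp_indicator_one hm hX hD] at hint
  exact (measureReal_eq_zero_iff).1 (le_antisymm hint measureReal_nonneg)

end condExp

/-- If `X n l` covers almost all of `side A l` and each `X n l` is almost contained in `F l`, where
`F false` and `F true` are almost disjoint, then `A` is almost equal to `F false`. -/
theorem ae_eq_of_side_covers {Ω : Type*} [MeasurableSpace Ω] {P : Measure Ω}
    [IsProbabilityMeasure P] {A : Set Ω} (hA : MeasurableSet A) (hAhalf : P A = 1 / 2)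
    {X : ℕ → Bool → Set Ω} (hX : ∀ n l, MeasurableSet (X n l))
    (hXsub : ∀ n l, X n l ⊆ side A l) (hXunion : ∀ l, P (⋃ n, X n l) = 1 / 2)
    {F : Bool → Set Ω} (hF : P (F false ∩ F true) = 0) (hXF : ∀ n l, P (X n l ∩ (F l)ᶜ) = 0) :
    A =ᵐ[P] F false := by
  have hside : ∀ l, P (side A l) = 1 / 2
    | false => hAhalf
    | true => by
      rw [side, prob_compl_eq_one_sub hA, hAhalf, one_div, ENNReal.one_sub_inv_two]
  have hdiff : ∀ l, P (side A l \ F l) = 0 := fun l => by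
    have h₁ : P (side A l \ ⋃ n, X n l) = 0 := by
      rw [measure_sdiff (iUnion_subset fun n => hXsub n l)
        (MeasurableSet.iUnion fun n => hX n l).nullMeasurableSet (measure_ne_top _ _),
        hside, hXunion, tsub_self]
    have h₂ : P (⋃ n, X n l ∩ (F l)ᶜ) = 0 := measure_iUnion_null fun n => hXF n l
    refine measure_mono_null (fun x hx => ?_) (measure_union_null h₁ h₂)
    by_cases hxU : x ∈ ⋃ n, X n l
    · rw [← iUnion_inter]
      exact Or.inr ⟨hxU, hx.2⟩
    · exact Or.inl ⟨hx.1, hxU⟩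
  rw [ae_eq_set]
  refine ⟨hdiff false, measure_mono_null (fun x hx => ?_) (measure_union_null hF (hdiff true))⟩
  by_cases hxF : x ∈ F true
  · exact Or.inl ⟨hx.1, hxF⟩
  · exact Or.inr ⟨hx.2, hxF⟩

theorem IndepFamily.not_ae_eq {Ω I : Type*} [MeasurableSpace Ω] {P : Measure Ω}
    {A : I → Set Ω} (hA : IndepFamily P A) (hhalf : ∀ i, P (A i) = 1 / 2) {i j : I}
    (hij : i ≠ j) : ¬ A i =ᵐ[P] A j := by
  classical
  intro h
  have h₁ : P (A i ∩ A j) = 1 / 2 := by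
    rw [← hhalf j]
    exact measure_congr ((h.inter (ae_eq_refl _)).trans (by rw [inter_self]; rfl))
  have h₂ := hA {i, j}
  rw [Finset.prod_pair hij, Finset.set_biInter_insert, Finset.set_biInter_singleton, h₁,
    hhalf, hhalf] at h₂
  have h₃ := congrArg ENNReal.toReal h₂
  norm_num at h₃

/-- If all `X i j`, `i ∈ S`, have the same conditional probability `f j` given the past, and the
`f j`, `j ∈ J₀`, are simultaneously positive on a non-null set, then finite intersections of sets
`X i j` with distinct `i ∈ S` and `j ∈ J₀` have positive measure. -/
theorem measure_biInter_pos {Ω ι J : Type*} [MeasurableSpace Ω] {P : Measure Ω}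
    [IsProbabilityMeasure P] {o : ι → Ordinal.{u}} (ho : Function.Injective o)
    {X : ι → J → Set Ω} (hX : ∀ i j, MeasurableSet (X i j)) {δ : Ordinal.{u}} {f : J → Ω → ℝ}
    {S : Set ι} (hδ : ∀ i ∈ S, δ ≤ o i)
    (hf : ∀ i ∈ S, ∀ j, P[(X i j).indicator (1 : Ω → ℝ) | sigmaBelow o X (o i)] = f j)
    {G : Set Ω} (hG : MeasurableSet[sigmaBelow o X δ] G) (hPG : 0 < P G) {J₀ : Set J}
    (hGf : ∀ j ∈ J₀, ∀ x ∈ G, 0 < f j x) (h : ι → J) (hh : ∀ i, h i ∈ J₀) (T : Finset ι)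
    (hT : ↑T ⊆ S) : 0 < P (G ∩ ⋂ i ∈ T, X i (h i)) := by
  classical
  induction T using Finset.induction_on_max_value o with
  | empty => simpa using hPG
  | insert a T haT hmax ih =>
    have haS : a ∈ S := hT (Finset.mem_insert_self a T)
    have hD : MeasurableSet[sigmaBelow o X (o a)] (G ∩ ⋂ i ∈ T, X i (h i)) := by
      refine @MeasurableSet.inter _ (_) _ _ (sigmaBelow_mono (hδ a haS) _ hG)
        (@Finset.measurableSet_biInter _ _ (_) _ T fun i hi => measurableSet_sigmaBelow ?_ _)
      exact lt_of_le_of_ne (hmax i hi) fun e => haT (ho e ▸ hi)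
    have hpos := measure_inter_pos_of_condExp_indicator_pos (sigmaBelow_le hX _) (hX a (h a)) hD
      (fun x hx => by rw [hf a haS]; exact hGf _ (hh a) x hx.1)
      (ih fun i hi => hT (Finset.mem_insert_of_mem hi))
    rwa [Finset.set_biInter_insert, inter_left_comm]

/-- **Claim 9.1 of Jin–Shelah.** Let `λ` be a regular cardinal with
`κ^ℵ₀ < λ` for all `κ < λ`, let `(A α)` be an independent `λ`-family of
measurable sets of measure `1/2`, and for each `α`, `n` and each side `l` let
`X α n l ⊆ (A α)^l` be measurable with `P (⋃ n, X α n l) = 1/2`. Then there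
are `E ⊆ λ` of cardinality `λ` and indices `n(α, l)` such that all finite
intersections `⋂ i < m, X (α i) (n (α i) (h i)) (h i)` over distinct members
`α i` of `E` and sides `h i` have positive measure. -/
theorem claim_9_1
    (lam : Cardinal.{u}) (hreg : lam.IsRegular)
    (hlam : ∀ κ : Cardinal.{u}, κ < lam → κ ^ Cardinal.aleph0 < lam)
    {Ω : Type u} [MeasurableSpace Ω] (P : Measure Ω) [IsProbabilityMeasure P]
    (A : lam.out → Set Ω) (hAmeas : ∀ α, MeasurableSet (A α))
    (hAindep : IndepFamily P A) (hAhalf : ∀ α, P (A α) = 1 / 2)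
    (X : lam.out → ℕ → Bool → Set Ω)
    (hXmeas : ∀ α n l, MeasurableSet (X α n l))
    (hXsub : ∀ α n l, X α n l ⊆ side (A α) l)
    (hXunion : ∀ α l, P (⋃ n, X α n l) = 1 / 2) :
    ∃ E : Set lam.out, Cardinal.mk E = lam ∧
      ∃ nn : lam.out → Bool → ℕ,
        ∀ (m : ℕ) (αs : Fin m → lam.out), Function.Injective αs →
          (∀ i, αs i ∈ E) → ∀ h : Fin m → Bool,
            0 < P (⋂ i : Fin m, X (αs i) (nn (αs i) (h i)) (h i)) := by
  classical
  have hω : Cardinal.aleph0 < lam :=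
    (Cardinal.cantor _).trans (hlam 2 ((Cardinal.natCast_lt_aleph0 (n := 2)).trans_le hreg.1))
  have hω₁ : Cardinal.aleph 1 < lam :=
    Cardinal.aleph_one_le_continuum.trans_lt
      (hlam 2 ((Cardinal.natCast_lt_aleph0 (n := 2)).trans_le hreg.1))
  obtain ⟨e⟩ : Nonempty (lam.out ≃ lam.ord.ToType) := Cardinal.eq.1 (by simp)
  let o : lam.out → Ordinal.{u} := fun α => (e α).toOrd
  have ho : Function.Injective o :=
    Subtype.val_injective.comp (Ordinal.ToType.mk.symm.injective.comp e.injective)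
  have hrange : range o = Iio lam.ord := by
    ext δ
    refine ⟨?_, fun hδ => ⟨e.symm (Ordinal.ToType.mk ⟨δ, hδ⟩), by simp [o]⟩⟩
    rintro ⟨α, rfl⟩
    exact (e α).toOrd.2
  let Y : lam.out → ℕ × Bool → Set Ω := fun α j => X α j.1 j.2
  have hY : ∀ α j, MeasurableSet (Y α j) := fun α j => hXmeas α j.1 j.2
  let g : lam.out → ℕ × Bool → Ω → ℝ := fun α j =>
    P[(Y α j).indicator (1 : Ω → ℝ) | sigmaBelow o Y (o α)]
  have hregr : ∀ α, ∃ δ, Cardinal.aleph0 < (o α).cof →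
      δ < o α ∧ ∀ j, Measurable[sigmaBelow o Y δ] (g α j) := fun α => by
    by_cases hα : Cardinal.aleph0 < (o α).cof
    · obtain ⟨δ, hδ, h⟩ := exists_lt_measurable_sigmaBelow (f := g α) hα
        fun j => stronglyMeasurable_condExp.measurable
      exact ⟨δ, fun _ => ⟨hδ, h⟩⟩
    · exact ⟨0, fun h => absurd h hα⟩
  choose γ hγ using hregr
  obtain ⟨δ, hδ, hcard⟩ := hreg.exists_card_regressive_le hω₁ (Cardinal.mk_out lam) o hrange γ
    fun α hα => (hγ α hα).1
  obtain ⟨T, -, hTcard, hTg⟩ := exists_card_eq_of_measurable_sigmaBelow (X := Y) hreg hω hlam ho hδ g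
    hcard.ge fun α hα j => ((hγ α hα.1).2 j).mono (sigmaBelow_mono hα.2) le_rfl
  have hT₂ : T.Nontrivial := by
    rw [← Set.nontrivial_coe_sort, ← Cardinal.one_lt_iff_nontrivial]
    exact Cardinal.one_lt_aleph0.trans (hω.trans_le hTcard)
  obtain ⟨α₀, hα₀, hmin⟩ : ∃ α₀ ∈ T, ∀ α ∈ T, o α₀ ≤ o α :=
    ⟨_, Function.argminOn_mem o T hT₂.nonempty, fun α hα => Function.argminOn_le o T hα⟩
  have hgm : ∀ j, Measurable[sigmaBelow o Y (o α₀)] (g α₀ j) := fun j =>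
    stronglyMeasurable_condExp.measurable
  have hpos : ∀ j, MeasurableSet[sigmaBelow o Y (o α₀)] {x | 0 < g α₀ j x} := fun j =>
    hgm j measurableSet_Ioi
  obtain ⟨n₀, n₁, hn⟩ : ∃ n₀ n₁ : ℕ,
      0 < P ({x | 0 < g α₀ (n₀, false) x} ∩ {x | 0 < g α₀ (n₁, true) x}) := by
    by_contra! hnull
    let F : Bool → Set Ω := fun l => ⋃ n : ℕ, {x | 0 < g α₀ (n, l) x}
    have hF : P (F false ∩ F true) = 0 := by
      simp only [F, iUnion_inter, inter_iUnion]
      exact measure_iUnion_null fun n => measure_iUnion_null fun n' => le_zero_iff.1 (hnull n' n)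
    have hAF : ∀ α ∈ T, A α =ᵐ[P] F false := fun α hα => by
      refine ae_eq_of_side_covers (hAmeas α) (hAhalf α) (hXmeas α) (hXsub α) (hXunion α) hF
        fun n l => ?_
      refine measure_mono_null (inter_subset_inter_right _ (compl_subset_compl.2
        (subset_iUnion (fun n : ℕ => {x | 0 < g α₀ (n, l) x}) n))) ?_
      refine measure_inter_eq_zero_of_condExp_indicator_nonpos (sigmaBelow_le hY (o α))
        (hXmeas α n l) (sigmaBelow_mono (hmin α hα) _ (hpos (n, l)).compl) fun x hx => ?_
      change g α (n, l) x ≤ 0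
      rw [hTg α hα α₀ hα₀]
      exact not_lt.1 hx
    obtain ⟨α, hα, β, hβ, hαβ⟩ := hT₂
    exact hAindep.not_ae_eq hAhalf hαβ ((hAF α hα).trans (hAF β hβ).symm)
  let nn : Bool → ℕ := fun l => cond l n₁ n₀
  refine ⟨T, le_antisymm ((Cardinal.mk_set_le T).trans_eq (Cardinal.mk_out lam)) hTcard,
    fun _ => nn, fun m αs hinj hαs h => ?_⟩
  let h' : lam.out → Bool := Function.extend αs h fun _ => false
  have hh' : ∀ i, h' (αs i) = h i := fun i => hinj.extend_apply _ _ _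
  refine (measure_biInter_pos ho hY hmin (fun α hα j => congrFun (hTg α hα α₀ hα₀) j)
    ((hpos (n₀, false)).inter (hpos (n₁, true))) hn (J₀ := range fun l => (nn l, l)) ?_
    (fun α => (nn (h' α), h' α)) (fun α => ⟨h' α, rfl⟩) (Finset.univ.image αs)
    (by simpa [Set.subset_def] using hαs)).trans_le (measure_mono fun x hx => ?_)
  · rintro _ ⟨l, rfl⟩ x hx
    cases l
    · exact hx.1
    · exact hx.2
  · refine mem_iInter.2 fun i => ?_
    have := mem_iInter₂.1 hx.2 (αs i) (Finset.mem_image_of_mem _ (Finset.mem_univ i))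
    rwa [hh'] at this
end

section
/- Let λ be a strong limit cardinal, let κ = cf(λ), and suppose μ^{ℵ₀} < κ for every cardinal μ < κ. Let (Ω, Σ, P) be a probability space with |Ω| = λ that carries an independent family (A_α)_{α<λ} of measurable sets with P(A_α) = 1/2 for every α < λ. Then (Ω, Σ, P) is not compact in the sense of Ross. (Paper's Theorem 10, with the independent family from Fact 3 stated as an explicit hypothesis.) -/
open MeasureTheory Set
open scoped ENNReal

open Cardinal MeasurableSpace
open scoped Ordinal

/-- Every measurable set `E` of positive measure has a conditional support `X` with respect to
a sub-σ-algebra `m`: an `m`-measurable set of positive measure, all of whose non-null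
`m`-measurable parts meet `E` in positive measure. -/
theorem exists_measurableSet_conditional_support {Ω : Type*} {m m₀ : MeasurableSpace Ω}
    (hm : m ≤ m₀) (P : Measure[m₀] Ω) [IsFiniteMeasure P] {E : Set Ω} (hE : MeasurableSet E)
    (hpos : P E ≠ 0) :
    ∃ X, MeasurableSet[m] X ∧ P X ≠ 0 ∧
      ∀ Z, MeasurableSet[m] Z → P (X ∩ Z) ≠ 0 → P (E ∩ (X ∩ Z)) ≠ 0 := by
  set g : Ω → ℝ := E.indicator 1 with hg
  have hgi : Integrable g P := (integrable_const (1 : ℝ)).indicator hE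
  set f : Ω → ℝ := P[g | m] with hf
  have hfi : Integrable f P := integrable_condExp
  have hX : MeasurableSet[m] {x | 0 < f x} :=
    (stronglyMeasurable_condExp.measurable : Measurable[m] f) measurableSet_Ioi
  refine ⟨{x | 0 < f x}, hX, fun h0 => ?_, fun Z hZ hXZ h0 => hXZ ?_⟩
  · have hle : ∀ᵐ x ∂P, f x ≤ 0 := by
      rw [ae_iff]
      simpa using h0
    have h1 : ∫ x, f x ∂P ≤ 0 := integral_nonpos_of_ae hle
    rw [hf, integral_condExp hm, hg, integral_indicator_one hE] at h1
    exact hpos ((measureReal_eq_zero_iff).1 (le_antisymm h1 measureReal_nonneg))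
  · have hY : MeasurableSet[m] ({x | 0 < f x} ∩ Z) := hX.inter hZ
    have h1 : ∫ x in {x | 0 < f x} ∩ Z, f x ∂P = 0 := by
      rw [hf, setIntegral_condExp hm hgi hY, hg, integral_indicator_one hE,
        measureReal_restrict_apply hE, measureReal_def, h0, ENNReal.toReal_zero]
    rw [setIntegral_eq_zero_iff_of_nonneg_ae _ hfi.integrableOn] at h1
    · have h2 := (ae_restrict_iff' (hm _ hY)).1 h1
      rw [ae_iff] at h2
      refine measure_mono_null (fun x hx => ?_) h2
      simp only [mem_ofPred_eq, Classical.not_imp]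
      exact ⟨hx, hx.1.ne'⟩
    · exact (ae_restrict_iff' (hm _ hY)).2 (.of_forall fun x hx => hx.1.le)

/-- A well-ordered chain of fewer than `κ` sets, each of cardinality less than `κ`, closed off
step by step under an operation `Φ` that preserves having cardinality less than `κ`. -/
theorem exists_closing_chain {I W : Type u} [LinearOrder W] [WellFoundedLT W] {κ : Cardinal.{u}}
    (hκ : κ.IsRegular) (hW : #W < κ) (Φ : Set I → Set I) (hΦ : ∀ M : Set I, #M < κ → #(Φ M) < κ) :
    ∃ M : W → Set I, (∀ w, #(M w) < κ) ∧ ∀ v w, v < w → M v ⊆ M w ∧ Φ (M v) ⊆ M w := by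
  let M : W → Set I := WellFounded.fix (wellFounded_lt (α := W))
    fun w rec => ⋃ v : Iio w, rec v v.2 ∪ Φ (rec v v.2)
  have hM : ∀ w, M w = ⋃ v : Iio w, M v ∪ Φ (M v) := fun w =>
    WellFounded.fix_eq _ _ _
  refine ⟨M, fun w => ?_, fun v w hvw => ?_⟩
  · induction w using WellFoundedLT.induction with
    | ind w ih =>
      rw [hM, card_iUnion_lt_iff_forall_of_isRegular hκ ((mk_set_le _).trans_lt hW)]
      rintro ⟨v, hv⟩
      exact (mk_union_le _ _).trans_lt (add_lt_of_lt hκ.aleph0_le (ih v hv) (hΦ _ (ih v hv)))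
  · rw [hM w, ← union_subset_iff]
    exact subset_iUnion (fun v : Iio w => M v ∪ Φ (M v)) ⟨v, hvw⟩

/-- The σ-algebra generated by the union of an increasing chain of families, along an order in
which sequences are bounded, is the union of the generated σ-algebras. -/
theorem exists_measurableSet_generateFrom_of_iUnion {Ω W : Type*} [LinearOrder W] [Nonempty W]
    (hW : ∀ u : ℕ → W, ∃ w, ∀ n, u n ≤ w) {G : W → Set (Set Ω)} (hG : Monotone G) {X : Set Ω}
    (hX : MeasurableSet[generateFrom (⋃ w, G w)] X) :
    ∃ w, MeasurableSet[generateFrom (G w)] X := by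
  induction X, hX using generateFrom_induction with
  | hC t ht _ =>
    obtain ⟨w, hw⟩ := mem_iUnion.1 ht
    exact ⟨w, measurableSet_generateFrom hw⟩
  | empty => exact ⟨Classical.arbitrary W, @MeasurableSet.empty _ (generateFrom _)⟩
  | compl t _ ih => exact ih.imp fun _ h => h.compl
  | iUnion s _ ih =>
    choose u hu using ih
    obtain ⟨w, hw⟩ := hW u
    exact ⟨w, MeasurableSet.iUnion fun n => generateFrom_mono (hG (hw n)) _ (hu n)⟩

/-- If `X` has the property that any fewer than `κ` members of `E` admit a further member which is
non-null on every non-null trace on `X` of a finite intersection of them, then `κ` many members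
of `E` have non-null finite intersections. -/
theorem exists_large_nonnull_inter_of_extension {Ω I : Type u} [MeasurableSpace Ω] (P : Measure Ω)
    {κ : Cardinal.{u}} (E : I → Set Ω) {X : Set Ω} (hX : P X ≠ 0)
    (h : ∀ J : Set I, #J < κ → ∃ i ∉ J, ∀ F : Finset I, ↑F ⊆ J →
      P (X ∩ ⋂ j ∈ F, E j) ≠ 0 → P (E i ∩ (X ∩ ⋂ j ∈ F, E j)) ≠ 0) :
    ∃ T : Set I, κ ≤ #T ∧ ∀ F : Finset I, ↑F ⊆ T → P (⋂ j ∈ F, E j) ≠ 0 := by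
  classical
  let 𝓕 : Set (Set I) := {T | ∀ F : Finset I, ↑F ⊆ T → P (X ∩ ⋂ j ∈ F, E j) ≠ 0}
  have hfin : Order.IsOfFiniteCharacter 𝓕 := fun T =>
    ⟨fun hT y hy _ F hF => hT F (hF.trans hy),
      fun hT F hF => hT F hF F.finite_toSet F subset_rfl⟩
  have hempty : (∅ : Set I) ∈ 𝓕 := fun F hF => by
    have : F = ∅ := by simpa using hF
    simpa [this] using hX
  obtain ⟨T, -, hT⟩ := hfin.exists_maximal hempty
  refine ⟨T, not_lt.1 fun hlt => ?_, fun F hF h0 =>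
    hT.prop F hF (measure_mono_null inter_subset_right h0)⟩
  obtain ⟨i, hi, hiT⟩ := h T hlt
  have hins : insert i T ∈ 𝓕 := by
    intro F hF
    have hF' : ↑(F.erase i) ⊆ T := by
      intro j hj
      simp only [Finset.coe_erase, mem_sdiff, mem_singleton_iff] at hj
      exact (hF hj.1).resolve_left hj.2
    refine fun h0 => hiT _ hF' (hT.prop _ hF') (measure_mono_null ?_ h0)
    rintro x ⟨hxi, hxX, hx⟩
    refine ⟨hxX, mem_iInter₂.2 fun j hj => ?_⟩
    by_cases hji : j = i
    · exact hji ▸ hxi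
    · exact mem_iInter₂.1 hx j (Finset.mem_erase.2 ⟨hji, hj⟩)
  exact hi (hT.le_of_ge hins (subset_insert i T) (mem_insert i T))

/-- A regular cardinal `κ` with `μ ^ ℵ₀ < κ` for all `μ < κ` is a precaliber of finite measures:
among `κ` many sets of positive measure there are `κ` many whose finite intersections all have
positive measure. -/
theorem exists_large_nonnull_inter {Ω I : Type u} [MeasurableSpace Ω] (P : Measure Ω)
    [IsFiniteMeasure P] {κ : Cardinal.{u}} (hκ : κ.IsRegular) (hμ : ∀ μ < κ, μ ^ ℵ₀ < κ)
    (hI : κ ≤ #I) (E : I → Set Ω) (hE : ∀ i, MeasurableSet (E i)) (hpos : ∀ i, P (E i) ≠ 0) :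
    ∃ T : Set I, κ ≤ #T ∧ ∀ F : Finset I, ↑F ⊆ T → P (⋂ j ∈ F, E j) ≠ 0 := by
  by_contra hcon
  have hbad : ∀ X : Set Ω, ∃ J : Set I, #J < κ ∧ (P X ≠ 0 → ∀ i ∉ J, ∃ F : Finset I, ↑F ⊆ J ∧
      P (X ∩ ⋂ j ∈ F, E j) ≠ 0 ∧ P (E i ∩ (X ∩ ⋂ j ∈ F, E j)) = 0) := by
    intro X
    by_cases hX : P X = 0
    · exact ⟨∅, by simpa using hκ.pos, fun h => (h hX).elim⟩
    · by_contra! hJ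
      refine hcon (exists_large_nonnull_inter_of_extension P E hX fun J hJκ => ?_)
      obtain ⟨-, i, hi, hF⟩ := hJ J hJκ
      exact ⟨i, hi, hF⟩
  choose J hJκ hJ using hbad
  let m : Set I → MeasurableSpace Ω := fun M => generateFrom (E '' M)
  have hcard : ∀ M : Set I, #M < κ → #{X | MeasurableSet[m M] X} < κ := fun M hM =>
    (cardinal_measurableSet_le _).trans_lt
      (hμ _ (max_lt (mk_image_le.trans_lt hM) (by exact_mod_cast hκ.nat_lt 2)))
  have hω : ℵ₁ < κ :=
    (aleph_one_le_continuum.trans_eq two_power_aleph0.symm).trans_lt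
      (hμ 2 (by exact_mod_cast hκ.nat_lt 2))
  let W := (ω₁ : Ordinal.{u}).ToType
  have hWcof : Order.cof W = ℵ₁ := by rw [Ordinal.cof_toType, cof_omega_one]
  have hWseq : ∀ u : ℕ → W, ∃ w, ∀ n, u n < w := by
    intro u
    have : ¬ IsCofinal (range u) := fun h => by
      have h1 := (Order.cof_le h).trans (countable_range u).le_aleph0
      rw [hWcof] at h1
      exact absurd h1 (not_le.2 aleph0_lt_aleph_one)
    obtain ⟨w, hw⟩ := not_isCofinal_iff.1 this
    exact ⟨w, fun n => hw _ (mem_range_self n)⟩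
  obtain ⟨M, hMκ, hM⟩ := exists_closing_chain (W := W) hκ
    (by simpa [W] using hω) (fun M => ⋃ X ∈ {X | MeasurableSet[m M] X}, J X)
    (fun M (hM : #M < κ) => (card_biUnion_lt_iff_forall_of_isRegular hκ (hcard M hM)).2 fun X _ => hJκ X)
  have hMmono : Monotone M := fun v w hvw => by
    rcases hvw.eq_or_lt with rfl | h
    exacts [subset_rfl, (hM v w h).1]
  have : Nonempty W := by
    rw [← Order.cof_ne_zero_iff, hWcof]
    exact (aleph_pos 1).ne'
  set N : Set I := ⋃ w, M w
  have hNκ : #N < κ :=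
    (card_iUnion_lt_iff_forall_of_isRegular hκ (by simpa [W] using hω)).2 hMκ
  obtain ⟨i, hi⟩ : ∃ i, i ∉ N := by
    by_contra! h
    rw [eq_univ_of_forall h, mk_univ] at hNκ
    exact hI.not_gt hNκ
  have hm : m N ≤ ‹MeasurableSpace Ω› := generateFrom_le (by rintro _ ⟨j, -, rfl⟩; exact hE j)
  obtain ⟨X, hX, hX0, hXE⟩ := exists_measurableSet_conditional_support hm P (hE i) (hpos i)
  have hJN : J X ⊆ N := by
    have hX' : MeasurableSet[generateFrom (⋃ w, E '' M w)] X := by rwa [← image_iUnion]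
    obtain ⟨v, hv⟩ := exists_measurableSet_generateFrom_of_iUnion
      (fun u => (hWseq u).imp fun w h n => (h n).le) (fun v w h => image_mono (hMmono h)) hX'
    obtain ⟨w, hw⟩ := hWseq fun _ => v
    exact (subset_biUnion_of_mem (u := J) hv).trans
      (((hM v w (hw 0)).2).trans (subset_iUnion M w))
  obtain ⟨F, hF, hF0, hF1⟩ := hJ X hX0 i fun h => hi (hJN h)
  exact hXE _ (Finset.measurableSet_biInter F fun j hj =>
    measurableSet_generateFrom (mem_image_of_mem E (hJN (hF hj)))) hF0 hF1

/-- Among `lam` many independent sets of measure `1/2`, two have the same trace on a given set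
of size less than the strong limit `lam`, so some non-null measurable set avoids that set. -/
theorem exists_nonnull_disjoint_of_lt {lam : Cardinal.{u}} (hsl : lam.IsStrongLimit)
    {Ω I : Type u} [MeasurableSpace Ω] (P : Measure Ω) [IsProbabilityMeasure P] (hI : #I = lam)
    (A : I → Set Ω) (hAmeas : ∀ α, MeasurableSet (A α))
    (hAindep : IndepFamily P A) (hAhalf : ∀ α, P (A α) = 1 / 2) {S : Set Ω} (hS : #S < lam) :
    ∃ D, MeasurableSet D ∧ P D ≠ 0 ∧ Disjoint D S := by
  classical
  obtain ⟨α, β, hαβ, hne⟩ : ∃ α β, (Subtype.val ⁻¹' A α : Set S) = Subtype.val ⁻¹' A β ∧ α ≠ β := by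
    by_contra! h
    have h1 := mk_le_of_injective (f := fun α => (Subtype.val ⁻¹' A α : Set S)) fun α β => h α β
    rw [hI, mk_set] at h1
    exact h1.not_gt (hsl.isStrongPrelimit hS)
  refine ⟨A α \ A β, (hAmeas α).diff (hAmeas β), fun h0 => ?_, ?_⟩
  · have h1 := hAindep {α, β}
    rw [Finset.prod_pair hne, hAhalf, hAhalf] at h1
    have h2 := measure_inter_add_sdiff (μ := P) (A α) (hAmeas β)
    simp only [Finset.mem_insert, Finset.mem_singleton, iInter_iInter_eq_or_left,
      iInter_iInter_eq_left] at h1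
    rw [h1, h0, hAhalf, add_zero] at h2
    have h3 := congrArg ENNReal.toReal h2
    norm_num at h3
  · rw [Set.disjoint_left]
    rintro x ⟨hxα, hxβ⟩ hxS
    exact hxβ ((Set.ext_iff.1 hαβ ⟨x, hxS⟩).1 hxα)

/-- **Theorem 10 of Jin–Shelah.** Let `λ` be a strong limit cardinal,
`κ = cf(λ)`, and suppose `μ^ℵ₀ < κ` for every `μ < κ`. If `(Ω, Σ, P)` is a
probability space of cardinality `λ` carrying an independent `λ`-family of
measurable sets of measure `1/2`, then `(Ω, Σ, P)` is not compact in the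
sense of Ross. -/
theorem not_rossCompact_of_strong_limit
    (lam κ : Cardinal.{u}) (hsl : lam.IsStrongLimit) (hκ : κ = lam.ord.cof)
    (hμ : ∀ μ : Cardinal.{u}, μ < κ → μ ^ Cardinal.aleph0 < κ)
    {Ω : Type u} [MeasurableSpace Ω] (P : Measure Ω) [IsProbabilityMeasure P]
    (hΩ : Cardinal.mk Ω = lam)
    (A : lam.out → Set Ω) (hAmeas : ∀ α, MeasurableSet (A α))
    (hAindep : IndepFamily P A) (hAhalf : ∀ α, P (A α) = 1 / 2) :
    ¬ RossCompact P := by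
  rintro ⟨C, hCmeas, hCreg, hCcompact⟩
  have hord : Order.IsSuccLimit lam.ord := isSuccLimit_ord hsl.aleph0_le
  have hreg : κ.IsRegular := hκ ▸ isRegular_cof hord
  obtain ⟨e⟩ : Nonempty (Ω ≃ lam.ord.ToType) := Cardinal.eq.1 (by simp [hΩ])
  obtain ⟨s, hs, hstype⟩ := Ordinal.exists_ord_cof_eq lam.ord.ToType
  rw [Ordinal.cof_toType, ← hκ] at hstype
  have hscard : #s = κ := by
    rw [← card_ord κ, ← hstype, Ordinal.card_type]
  have hB : ∀ i : s, ∃ B ∈ C, P B ≠ 0 ∧ ∀ x ∈ B, i.1 < e x := by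
    intro i
    have hS : #(e ⁻¹' Iic i.1) < lam := by
      rw [mk_preimage_equiv]
      exact (mk_Iic_lt i.1 (by simp) (by simpa using hsl.aleph0_le)).trans_eq (by simp)
    obtain ⟨D, hD, hD0, hDS⟩ :=
      exists_nonnull_disjoint_of_lt hsl P (mk_out lam) A hAmeas hAindep hAhalf hS
    have hsup := hCreg D hD
    have hlt : 0 < ⨆ (B : Set Ω) (_ : B ∈ C ∧ B ⊆ D), P B := hsup ▸ pos_iff_ne_zero.2 hD0
    obtain ⟨B, hB⟩ := lt_iSup_iff.1 hlt
    obtain ⟨⟨hBC, hBD⟩, hB0⟩ := lt_iSup_iff.1 hB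
    exact ⟨B, hBC, hB0.ne', fun x hx => not_le.1 (Set.disjoint_left.1 hDS (hBD hx))⟩
  choose B hBC hB0 hBe using hB
  obtain ⟨T, hT, hTF⟩ := exists_large_nonnull_inter P hreg hμ hscard.ge B
    (fun i => hCmeas _ (hBC i)) hB0
  obtain ⟨x, hx⟩ := hCcompact (B '' T) (by rintro _ ⟨i, -, rfl⟩; exact hBC i) fun F hF => by
    classical
    obtain ⟨F', hF', rfl⟩ := Finset.subset_set_image_iff.1 hF
    simpa using nonempty_of_measure_ne_zero (hTF F' hF')
  obtain ⟨j, hj, hxj⟩ := hs (e x)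
  obtain ⟨t, ht, hjt⟩ : ∃ t ∈ T, (⟨j, hj⟩ : s) ≤ t := by
    by_contra! h
    have h1 : #T ≤ #(Iio (⟨j, hj⟩ : s)) := mk_le_mk_of_subset fun t ht => h t ht
    have h2 := mk_Iio_lt (⟨j, hj⟩ : s) (by rw [hscard, hstype])
    exact (hT.trans h1).not_gt (h2.trans_eq hscard)
  exact (hBe t x (hx _ (mem_image_of_mem B ht))).not_ge (hxj.trans hjt)
end

section
/- Let Ω be a set, let (λ_α)_{α<κ} be an increasing sequence of infinite cardinals with 2^{λ_α} < λ_{α+1} for every α < κ, let λ = sup_{α<κ} λ_α, let (A_β)_{β<λ} be any family of subsets of Ω, and for each α < κ let Ω_α ⊆ Ω be a subset with |Ω_α| ≤ λ_α. Then for every α < κ there exist two distinct ordinals γ_α, γ'_α ∈ [λ_α, λ_{α+1}) such that (A_{γ_α} Δ A_{γ'_α}) ∩ Ω_α = ∅, where Δ denotes symmetric difference. (Paper's Claim 10.1.) -/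
open MeasureTheory Set

/-- If `2 ^ #S < ν` and `μ < ν` with `ν` infinite, then among the `ν` many sets indexed by
`[μ, ν)` two have the same trace on `S`. -/
theorem exists_ne_symmDiff_inter_eq_empty {Ω : Type u} {μ ν : Cardinal.{u}}
    (hν : Cardinal.aleph0 ≤ ν) (hμν : μ < ν) (A : Ordinal.{u} → Set Ω) (S : Set Ω)
    (hS : 2 ^ Cardinal.mk S < ν) :
    ∃ γ γ' : Ordinal.{u}, γ ≠ γ' ∧ γ ∈ Set.Ico μ.ord ν.ord ∧ γ' ∈ Set.Ico μ.ord ν.ord ∧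
      symmDiff (A γ) (A γ') ∩ S = ∅ := by
  let trace : Set.Iio ν.ord → Set S := fun x => Subtype.val ⁻¹' A (μ.ord + x)
  have hnot : ¬ Function.Injective trace := by
    intro hinj
    have hle := Cardinal.lift_mk_le_lift_mk_of_injective hinj
    rw [Cardinal.mk_Iio_ordinal, Cardinal.mk_set, Cardinal.card_ord, Cardinal.lift_lift,
      Cardinal.lift_le] at hle
    exact hS.not_ge hle
  obtain ⟨x, y, hxy, hne⟩ := Function.not_injective_iff.1 hnot
  have hmem (z : Set.Iio ν.ord) : μ.ord + z ∈ Set.Ico μ.ord ν.ord :=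
    ⟨le_self_add, Ordinal.isPrincipal_add_ord hν (Cardinal.ord_lt_ord.2 hμν) z.2⟩
  refine ⟨μ.ord + x, μ.ord + y, fun h => hne (Subtype.ext (add_left_cancel h)),
    hmem x, hmem y, ?_⟩
  ext ω
  simp only [Set.mem_inter_iff, Set.mem_symmDiff, Set.mem_empty_iff_false, iff_false]
  rintro ⟨h, hω⟩
  have htrace : ω ∈ A (μ.ord + x) ↔ ω ∈ A (μ.ord + y) := Set.ext_iff.1 hxy ⟨ω, hω⟩
  tauto

/-- **Claim 10.1 of Jin–Shelah.** Let `(λ_α)_{α<κ}` be an increasing sequence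
of infinite cardinals with `2^{λ_α} < λ_{α+1}`, let `λ = sup λ_α`, let
`(A_β)` be any family of subsets of `Ω`, and let `Ω_α ⊆ Ω` with
`|Ω_α| ≤ λ_α`. Then for every `α < κ` there are two distinct ordinals
`γ, γ' ∈ [λ_α, λ_{α+1})` with `(A_γ Δ A_{γ'}) ∩ Ω_α = ∅`. -/
theorem claim_10_1
    {Ω : Type u} (κ : Cardinal.{u}) (lam : Ordinal.{u} → Cardinal.{u})
    (hmono : ∀ α β : Ordinal.{u}, α < β → β < κ.ord → lam α < lam β)
    (hinf : ∀ α : Ordinal.{u}, α < κ.ord → Cardinal.aleph0 ≤ lam α)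
    (hexp : ∀ α : Ordinal.{u}, α < κ.ord → 2 ^ lam α < lam (α + 1))
    (l : Cardinal.{u}) (hl : l = ⨆ α : Set.Iio κ.ord, lam ↑α)
    (A : Ordinal.{u} → Set Ω)
    (Ωs : Ordinal.{u} → Set Ω)
    (hΩs : ∀ α : Ordinal.{u}, α < κ.ord → Cardinal.mk (Ωs α) ≤ lam α) :
    ∀ α : Ordinal.{u}, α < κ.ord →
      ∃ γ γ' : Ordinal.{u}, γ ≠ γ' ∧
        γ ∈ Set.Ico (lam α).ord (lam (α + 1)).ord ∧
        γ' ∈ Set.Ico (lam α).ord (lam (α + 1)).ord ∧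
        symmDiff (A γ) (A γ') ∩ Ωs α = ∅ := by
  intro α hα
  have hlt : lam α < lam (α + 1) := (Cardinal.cantor _).trans (hexp α hα)
  exact exists_ne_symmDiff_inter_eq_empty ((hinf α hα).trans hlt.le) hlt A (Ωs α)
    ((Cardinal.power_le_power_left two_ne_zero (hΩs α hα)).trans_lt (hexp α hα))
end

section
/- Let κ be a regular uncountable cardinal such that μ^{ℵ₀} < κ for every cardinal μ < κ. Let (Ω, Σ, P) be a probability space and (B_α)_{α<κ} an independent family of measurable sets with P(B_α) = 1/2 for all α. For each α < κ and n ∈ ℕ let X_{α,n} be a measurable set with X_{α,n} ⊆ B_α and P(⋃_{n∈ℕ} X_{α,n}) = 1/2. Then there exist a set E ⊆ κ with |E| = κ and a natural number n(α) for each α ∈ E such that for every m ∈ ℕ and every choice of distinct α₀, …, α_{m−1} ∈ E, one has P(⋂_{i<m} X_{α_i, n(α_i)}) > 0; in particular {X_{α,n(α)} : α ∈ E} has the finite intersection property. (The one-sided variant of the paper's Claim 9.1, used in the proofs of Theorems 10 and 13.) -/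
open MeasureTheory Set
open scoped ENNReal

open Cardinal in
theorem exists_forall_lt_of_nat_seq_aleph_one (s : ℕ → (ℵ₁ : Cardinal.{u}).ord.ToType) :
    ∃ i, ∀ n, s n < i := by
  by_contra! h
  have hcof : IsCofinal (range s) := fun i ↦ by
    obtain ⟨n, hn⟩ := h i
    exact ⟨s n, mem_range_self n, hn⟩
  have hle := Order.cof_le hcof
  rw [Ordinal.cof_toType, isRegular_aleph_one.cof_ord] at hle
  exact absurd (hle.trans (le_aleph0_iff_set_countable.2 (countable_range s)))
    (not_le.2 aleph0_lt_aleph_one)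

open Cardinal in
/-- An operator on sets preserving cardinality `< κ` can be iterated along `ω₁`. -/
theorem exists_monotone_chain_of_isRegular {J : Type u} {κ : Cardinal.{u}} (hreg : κ.IsRegular)
    (hκ : ℵ₁ < κ) (F : Set J → Set J) (hF : ∀ D : Set J, #D < κ → #(F D) < κ) :
    ∃ D : (ℵ₁ : Cardinal.{u}).ord.ToType → Set J,
      Monotone D ∧ (∀ i j, i < j → F (D i) ⊆ D j) ∧ #(⋃ i, D i) < κ := by
  let D : (ℵ₁ : Cardinal.{u}).ord.ToType → Set J :=
    WellFounded.fix wellFounded_lt fun i D ↦ ⋃ j : Iio i, F (D j.1 j.2)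
  have hD : ∀ i, D i = ⋃ j : Iio i, F (D j) := fun i ↦ WellFounded.fix_eq _ _ _
  refine ⟨D, fun i j hij ↦ ?_, fun i j hij ↦ ?_, ?_⟩
  · rw [hD i, hD j]
    exact iUnion_subset fun k ↦
      subset_iUnion_of_subset (⟨k, k.2.trans_le hij⟩ : Iio j) subset_rfl
  · rw [hD j]
    exact subset_iUnion_of_subset (⟨i, hij⟩ : Iio j) subset_rfl
  · rw [card_iUnion_lt_iff_forall_of_isRegular hreg (by simpa using hκ)]
    intro i
    induction i using WellFoundedLT.induction with
    | ind i ih =>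
      rw [hD i, card_iUnion_lt_iff_forall_of_isRegular hreg
        (((mk_set_le _).trans_eq (mk_ord_toType _)).trans_lt hκ)]
      exact fun j ↦ hF _ (ih j j.2)

/-- A set in the σ-algebra generated by an `ω₁`-directed union already appears at some stage. -/
theorem exists_measurableSet_generateFrom_of_iUnion_s15 {Ω J I : Type*} [Preorder I] [Nonempty I]
    (hI : ∀ s : ℕ → I, ∃ i, ∀ n, s n < i) (X : J → Set Ω) {D : I → Set J} (hD : Monotone D)
    {G : Set Ω} (hG : MeasurableSet[MeasurableSpace.generateFrom (X '' ⋃ i, D i)] G) :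
    ∃ i, MeasurableSet[MeasurableSpace.generateFrom (X '' D i)] G := by
  induction G, hG using MeasurableSpace.generateFrom_induction with
  | hC t ht _ =>
    obtain ⟨a, ha, rfl⟩ := ht
    obtain ⟨i, hi⟩ := mem_iUnion.1 ha
    exact ⟨i, MeasurableSpace.measurableSet_generateFrom (mem_image_of_mem X hi)⟩
  | empty =>
    exact ⟨Classical.arbitrary I, MeasurableSpace.measurableSet_empty _⟩
  | compl t _ ih =>
    obtain ⟨i, hi⟩ := ih
    exact ⟨i, hi.compl⟩
  | iUnion s _ ih =>
    choose f hf using ih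
    obtain ⟨i, hi⟩ := hI f
    exact ⟨i, MeasurableSet.iUnion fun n ↦
      MeasurableSpace.generateFrom_mono (image_mono (hD (hi n).le)) _ (hf n)⟩

/-- The essential support of `A` relative to a sub-σ-algebra. -/
theorem exists_measurableSet_essential_support {Ω : Type*} {m m0 : MeasurableSpace Ω}
    (hm : m ≤ m0) (P : Measure Ω) [IsFiniteMeasure P] {A : Set Ω} (hA : P A ≠ 0) :
    ∃ G, MeasurableSet[m] G ∧ P G ≠ 0 ∧
      ∀ B, MeasurableSet[m] B → P (B ∩ G) ≠ 0 → P (B ∩ A) ≠ 0 := by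
  let ν := (P.restrict A).trim hm
  have hν : ν ≪ P.trim hm := Measure.absolutelyContinuous_restrict.trim hm
  have hmeas : Measurable[m] (ν.rnDeriv (P.trim hm)) := Measure.measurable_rnDeriv _ _
  have hG : MeasurableSet[m] {x | ν.rnDeriv (P.trim hm) x ≠ 0} :=
    hmeas (measurableSet_singleton 0).compl
  have key : ∀ B, MeasurableSet[m] B →
      (P (B ∩ A) = 0 ↔ P (B ∩ {x | ν.rnDeriv (P.trim hm) x ≠ 0}) = 0) := fun B hB ↦ by
    have hνB : ν B = P (B ∩ A) := by
      rw [trim_measurableSet_eq hm hB, Measure.restrict_apply (hm _ hB)]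
    rw [← hνB, ← trim_measurableSet_eq hm (hB.inter hG), inter_comm,
      ← withDensity_apply_eq_zero hmeas, Measure.withDensity_rnDeriv_eq ν _ hν]
  refine ⟨_, hG, ?_, fun B hB h ↦ (key B hB).not.2 h⟩
  simpa using (key univ MeasurableSet.univ).not.1 (by simpa using hA)

open Cardinal in
/-- Some set `G` of positive measure is, beyond every small set `D` of indices, contained in the
essential support of some `X α` relative to the σ-algebra generated by `X β`, `β ∈ D`. -/
theorem exists_common_essential_support {J Ω : Type u} (hreg : (#J).IsRegular)
    (hμ : ∀ μ : Cardinal.{u}, μ < #J → μ ^ ℵ₀ < #J) (hJ : ℵ₀ < #J)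
    [MeasurableSpace Ω] (P : Measure Ω) [IsFiniteMeasure P]
    (X : J → Set Ω) (hX : ∀ α, MeasurableSet (X α)) (hpos : ∀ α, P (X α) ≠ 0) :
    ∃ (G : Set Ω) (C : Set J), #C < #J ∧
      MeasurableSet[MeasurableSpace.generateFrom (X '' C)] G ∧ P G ≠ 0 ∧
      ∀ D : Set J, #D < #J → ∃ α ∉ D,
        ∀ A, MeasurableSet[MeasurableSpace.generateFrom (X '' D)] A →
          P (A ∩ G) ≠ 0 → P (A ∩ X α) ≠ 0 := by
  by_contra! h
  have hsmall : ∀ D : Set J, #D < #J →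
      #{G | MeasurableSet[MeasurableSpace.generateFrom (X '' D)] G} < #J := fun D hD ↦
    (MeasurableSpace.cardinal_measurableSet_le _).trans_lt
      (hμ _ (max_lt (mk_image_le.trans_lt hD) ((natCast_lt_aleph0 (n := 2)).trans hJ)))
  have hall : ∀ G : Set Ω, ∃ D : Set J, ∀ C : Set J, #C < #J →
      MeasurableSet[MeasurableSpace.generateFrom (X '' C)] G → P G ≠ 0 →
      #D < #J ∧ ∀ α ∉ D, ∃ A, MeasurableSet[MeasurableSpace.generateFrom (X '' D)] A ∧
        P (A ∩ G) ≠ 0 ∧ P (A ∩ X α) = 0 := fun G ↦ by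
    by_cases hG : ∃ C : Set J, #C < #J ∧
        MeasurableSet[MeasurableSpace.generateFrom (X '' C)] G ∧ P G ≠ 0
    · obtain ⟨C, hC, hGC, hG0⟩ := hG
      obtain ⟨D, hD⟩ := h G C hC hGC hG0
      exact ⟨D, fun _ _ _ _ ↦ hD⟩
    · exact ⟨∅, fun C hC hGC hG0 ↦ absurd ⟨C, hC, hGC, hG0⟩ hG⟩
  choose bad hbad using hall
  obtain ⟨D, hmono, hstep, hcard⟩ := exists_monotone_chain_of_isRegular hreg
    (aleph_one_le_continuum.trans_lt (hμ 2 ((natCast_lt_aleph0 (n := 2)).trans hJ)))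
    (fun (D : Set J) ↦
      ⋃ G ∈ {G | MeasurableSet[MeasurableSpace.generateFrom (X '' D)] G ∧ P G ≠ 0}, bad G)
    (fun (D : Set J) hD ↦ (card_biUnion_lt_iff_forall_of_isRegular hreg
      ((mk_le_mk_of_subset fun _ hG ↦ hG.1).trans_lt (hsmall D hD))).2
      fun G hG ↦ (hbad G D hD hG.1 hG.2).1)
  obtain ⟨α, hα⟩ : ∃ α, α ∉ ⋃ i, D i := by
    by_contra! hD
    rw [eq_univ_of_forall hD, mk_univ] at hcard
    exact hcard.false
  obtain ⟨G, hG, hG0, hGα⟩ := exists_measurableSet_essential_support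
    (MeasurableSpace.generateFrom_le (by rintro _ ⟨β, -, rfl⟩; exact hX β) :
      MeasurableSpace.generateFrom (X '' ⋃ i, D i) ≤ _) P (hpos α)
  have : Nonempty (ℵ₁ : Cardinal.{u}).ord.ToType :=
    mk_ne_zero_iff.1 (by rw [mk_ord_toType]; exact (aleph_pos 1).ne')
  obtain ⟨i, hi⟩ := exists_measurableSet_generateFrom_of_iUnion_s15
    exists_forall_lt_of_nat_seq_aleph_one X hmono hG
  obtain ⟨j, hj⟩ := exists_forall_lt_of_nat_seq_aleph_one fun _ ↦ i
  have hsub : bad G ⊆ ⋃ i, D i :=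
    ((subset_biUnion_of_mem (u := bad) (show G ∈ {G | MeasurableSet[
      MeasurableSpace.generateFrom (X '' D i)] G ∧ P G ≠ 0} from ⟨hi, hG0⟩)).trans
      (hstep i j (hj 0))).trans (subset_iUnion D j)
  obtain ⟨A, hA, hAG, hAα⟩ := (hbad G (D i)
    ((mk_le_mk_of_subset (subset_iUnion D i)).trans_lt hcard) hi hG0).2 α (fun hm ↦ hα (hsub hm))
  exact hGα A (MeasurableSpace.generateFrom_mono (image_mono hsub) _ hA) hAG hAα

open Cardinal in
/-- If `κ` is regular uncountable and `μ ^ ℵ₀ < κ` for `μ < κ`, then `κ` is a precaliber of every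
finite measure. -/
theorem exists_centered_subfamily {J Ω : Type u} (hreg : (#J).IsRegular)
    (hμ : ∀ μ : Cardinal.{u}, μ < #J → μ ^ ℵ₀ < #J) (hJ : ℵ₀ < #J)
    [MeasurableSpace Ω] (P : Measure Ω) [IsFiniteMeasure P]
    (X : J → Set Ω) (hX : ∀ α, MeasurableSet (X α)) (hpos : ∀ α, P (X α) ≠ 0) :
    ∃ E : Set J, #E = #J ∧ ∀ F : Set J, F ⊆ E → F.Finite → P (⋂ α ∈ F, X α) ≠ 0 := by
  obtain ⟨G, C, hC, hGC, hG0, hext⟩ := exists_common_essential_support hreg hμ hJ P X hX hpos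
  let S : Set (Set J) := {E | ∀ F ⊆ E, F.Finite → P ((⋂ α ∈ F, X α) ∩ G) ≠ 0}
  have hS : Order.IsOfFiniteCharacter S := fun E ↦
    ⟨fun hE F hF _ F' hF' hfin ↦ hE F' (hF'.trans hF) hfin,
      fun hE F hF hfin ↦ hE F hF hfin F subset_rfl hfin⟩
  obtain ⟨E, -, hE, hmax⟩ := hS.exists_maximal (x := ∅) fun F hF _ ↦ by
    simpa [subset_empty_iff.1 hF] using hG0
  refine ⟨E, (mk_set_le E).eq_of_not_lt fun hlt ↦ ?_, fun F hF hfin h0 ↦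
    hE F hF hfin (measure_mono_null inter_subset_left h0)⟩
  obtain ⟨α, hα, hαG⟩ := hext (E ∪ C)
    ((mk_union_le E C).trans_lt (add_lt_of_lt hreg.aleph0_le hlt hC))
  refine hα (Or.inl (hmax (y := insert α E) (fun F hF hfin h0 ↦ ?_) (subset_insert α E)
    (mem_insert α E)))
  have hFE : F \ {α} ⊆ E := by rwa [sdiff_singleton_subset_iff]
  have hmeas : MeasurableSet[MeasurableSpace.generateFrom (X '' (E ∪ C))]
      ((⋂ β ∈ F \ {α}, X β) ∩ G) :=
    (MeasurableSet.biInter hfin.sdiff.countable fun β hβ ↦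
      MeasurableSpace.measurableSet_generateFrom (mem_image_of_mem X (Or.inl (hFE hβ)))).inter
      (MeasurableSpace.generateFrom_mono (image_mono subset_union_right) _ hGC)
  refine hαG _ hmeas (by rw [inter_assoc, inter_self]; exact hE _ hFE hfin.sdiff)
    (measure_mono_null ?_ h0)
  rintro x ⟨⟨hx, hxG⟩, hxα⟩
  refine ⟨mem_iInter₂.2 fun β hβ ↦ ?_, hxG⟩
  by_cases hβα : β = α
  · exact hβα ▸ hxα
  · exact mem_iInter₂.1 hx β ⟨hβ, hβα⟩

/-- **One-sided variant of Claim 9.1 of Jin–Shelah** (used in Theorems 10 and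
13). Let `κ` be a regular uncountable cardinal with `μ^ℵ₀ < κ` for all
`μ < κ`, let `(B α)` be an independent `κ`-family of measurable sets of
measure `1/2`, and for each `α`, `n` let `X α n ⊆ B α` be measurable with
`P (⋃ n, X α n) = 1/2`. Then there are `E ⊆ κ` of cardinality `κ` and indices
`n(α)` such that every finite intersection of the sets `X α (n α)`, `α ∈ E`,
has positive measure; in particular `{X α (n α) : α ∈ E}` has the finite
intersection property. -/
theorem claim_9_1_one_sided
    (κ : Cardinal.{u}) (hreg : κ.IsRegular) (hκ : Cardinal.aleph0 < κ)
    (hμ : ∀ μ : Cardinal.{u}, μ < κ → μ ^ Cardinal.aleph0 < κ)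
    {Ω : Type u} [MeasurableSpace Ω] (P : Measure Ω) [IsProbabilityMeasure P]
    (B : κ.out → Set Ω) (hBmeas : ∀ α, MeasurableSet (B α))
    (hBindep : IndepFamily P B) (hBhalf : ∀ α, P (B α) = 1 / 2)
    (X : κ.out → ℕ → Set Ω)
    (hXmeas : ∀ α n, MeasurableSet (X α n))
    (hXsub : ∀ α n, X α n ⊆ B α)
    (hXunion : ∀ α, P (⋃ n, X α n) = 1 / 2) :
    ∃ E : Set κ.out, Cardinal.mk E = κ ∧
      ∃ nn : κ.out → ℕ,
        (∀ (m : ℕ) (αs : Fin m → κ.out), Function.Injective αs →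
          (∀ i, αs i ∈ E) → 0 < P (⋂ i : Fin m, X (αs i) (nn (αs i)))) ∧
        HasFIP {S : Set Ω | ∃ α ∈ E, S = X α (nn α)} := by
  have hpos : ∀ α, ∃ n, P (X α n) ≠ 0 := fun α ↦ by
    by_contra! h
    exact absurd ((hXunion α).symm.trans (measure_iUnion_null h)) (by simp)
  choose nn hnn using hpos
  have hmk : Cardinal.mk κ.out = κ := Cardinal.mk_out κ
  obtain ⟨E, hE, hfin⟩ := exists_centered_subfamily (J := κ.out) (by rwa [hmk]) (by rwa [hmk])
    (by rwa [hmk]) P (fun α ↦ X α (nn α)) (fun α ↦ hXmeas α _) hnn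
  refine ⟨E, hE.trans hmk, nn, fun m αs _ hαs ↦ ?_, fun F hF ↦ ?_⟩
  · rw [pos_iff_ne_zero]
    simpa [biInter_range] using hfin (range αs) (range_subset_iff.2 hαs) (finite_range αs)
  · have : Nonempty κ.out := Cardinal.mk_ne_zero_iff.1 (by rw [hmk]; exact hreg.pos.ne')
    have hF' : ∀ S ∈ F, ∃ α ∈ E, S = X α (nn α) := fun S hS ↦ hF hS
    choose! a ha haX using hF'
    have hne := nonempty_of_measure_ne_zero
      (hfin (a '' F) (image_subset_iff.2 fun S hS ↦ ha S hS) (F.finite_toSet.image a))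
    refine hne.mono fun x hx S hS ↦ ?_
    rw [haX S hS]
    exact mem_iInter₂.1 hx (a S) (mem_image_of_mem a hS)
end
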